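/- arXiv:1011.2142 — 3 statements merged into one kernel-verified Lean document; each statement's English description precedes it below -/
import Mathlib

section
/- Let f : ℝ^d → ℝ be continuous, bounded from below, and even (f(-x) = f(x) for all x). Then (∫ e^{-f} dγ_d) · (∫ e^{Hf} dγ_d) ≤ 1, where γ_d is the standard Gaussian measure on ℝ^d. -/
open MeasureTheory Real

/-- The standard Gaussian probability measure on `ℝ^d`, given by its density
`(2π)^{-d/2} e^{-|x|²/2}` with respect to Lebesgue measure. -/
noncomputable def stdGauss (d : ℕ) : Measure (EuclideanSpace ℝ (Fin d)) :=
  volume.withDensity fun x =>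
    ENNReal.ofReal ((2 * π) ^ (-(d : ℝ) / 2) * Real.exp (-‖x‖ ^ 2 / 2))

/-- The quadratic infimum convolution `Hf(x) = inf_y (f(x+y) + |y|²/2)`. -/
noncomputable def Hconv {E : Type*} [NormedAddCommGroup E] (f : E → ℝ) (x : E) : ℝ :=
  ⨅ y : E, (f (x + y) + ‖y‖ ^ 2 / 2)

/-- One-dimensional Brunn–Minkowski inequality. -/
theorem volume_add_volume_le_of_add_subset {A B S : Set ℝ} (hA : MeasurableSet A)
    (hB : MeasurableSet B) (hAne : A.Nonempty) (hBne : B.Nonempty)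
    (hS : ∀ a ∈ A, ∀ b ∈ B, a + b ∈ S) : volume A + volume B ≤ volume S := by
  have compact_case : ∀ K ⊆ A, IsCompact K → ∀ L ⊆ B, IsCompact L →
      volume K + volume L ≤ volume S := by
    have nonempty_case : ∀ K ⊆ A, IsCompact K → K.Nonempty → ∀ L ⊆ B, IsCompact L →
        L.Nonempty → volume K + volume L ≤ volume S := by
      intro K hKA hK hKne L hLB hL hLne
      obtain ⟨m, hm⟩ := hK.exists_isGreatest hKne
      obtain ⟨l, hl⟩ := hL.exists_isLeast hLne
      have hinter : volume (((l + ·) '' K) ∩ ((m + ·) '' L)) = 0 := by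
        refine measure_mono_null (t := {m + l}) ?_ (by simp)
        rintro _ ⟨⟨x, hx, rfl⟩, ⟨y, hy, hxy⟩⟩
        have h1 := hm.2 hx
        have h2 := hl.2 hy
        simp only [Set.mem_singleton_iff] at hxy ⊢
        linarith
      have hLm : MeasurableSet ((m + ·) '' L) :=
        (hL.image (continuous_const_add m)).measurableSet
      calc volume K + volume L
          = volume ((l + ·) '' K) + volume ((m + ·) '' L) := by
            simp [Set.image_add_left, measure_preimage_add]
        _ = volume (((l + ·) '' K) ∪ ((m + ·) '' L)) := by
            rw [← measure_union_add_inter _ hLm, hinter, add_zero]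
        _ ≤ volume S := by
            refine measure_mono ?_
            rintro _ (⟨x, hx, rfl⟩ | ⟨y, hy, rfl⟩)
            · simpa [add_comm] using hS x (hKA hx) l (hLB hl.1)
            · exact hS m (hKA hm.1) y (hLB hy)
    intro K hKA hK L hLB hL
    obtain ⟨a, ha⟩ := hAne
    obtain ⟨b, hb⟩ := hBne
    refine le_trans ?_ (nonempty_case (insert a K) (Set.insert_subset ha hKA) (hK.insert a)
      (Set.insert_nonempty a K) (insert b L) (Set.insert_subset hb hLB) (hL.insert b)
      (Set.insert_nonempty b L))
    gcongr <;> exact Set.subset_insert _ _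
  rw [hA.measure_eq_iSup_isCompact, hB.measure_eq_iSup_isCompact]
  simp only [iSup_and']
  refine ENNReal.biSup_add_biSup_le' ⟨∅, by simp⟩ ⟨∅, by simp⟩ ?_
  exact fun K hK L hL => compact_case K hK.1 hK.2 L hL.1 hL.2

/-- Sup-normalised one-dimensional Prékopa–Leindler inequality. -/
theorem lintegral_add_lintegral_le_of_min_le {φ ψ H : ℝ → ℝ} (hφ : Measurable φ)
    (hψ : Measurable ψ) (hH : Measurable H) (hφ0 : ∀ x, 0 ≤ φ x) (hψ0 : ∀ x, 0 ≤ ψ x)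
    (hH0 : ∀ x, 0 ≤ H x) (hφ1 : ∀ x, φ x ≤ 1) (hψ1 : ∀ x, ψ x ≤ 1)
    (hφs : ∀ r < 1, ∃ x, r < φ x) (hψs : ∀ r < 1, ∃ x, r < ψ x)
    (h : ∀ x y, min (φ x) (ψ y) ≤ H (x + y)) :
    (∫⁻ x, ENNReal.ofReal (φ x)) + ∫⁻ x, ENNReal.ofReal (ψ x) ≤ ∫⁻ x, ENNReal.ofReal (H x) := by
  rw [lintegral_eq_lintegral_meas_lt _ (ae_of_all _ hφ0) hφ.aemeasurable,
    lintegral_eq_lintegral_meas_lt _ (ae_of_all _ hψ0) hψ.aemeasurable,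
    lintegral_eq_lintegral_meas_lt _ (ae_of_all _ hH0) hH.aemeasurable]
  have hmeas : Measurable fun t : ℝ => volume {a : ℝ | t < φ a} :=
    Antitone.measurable fun s t hst => measure_mono fun a ha => lt_of_le_of_lt hst ha
  rw [← lintegral_add_left hmeas]
  refine lintegral_mono fun t => ?_
  rcases lt_or_ge t 1 with ht | ht
  · refine volume_add_volume_le_of_add_subset (measurableSet_lt measurable_const hφ)
      (measurableSet_lt measurable_const hψ) (hφs t ht) (hψs t ht) fun a ha b hb => ?_
    exact lt_of_lt_of_le (lt_min ha hb) (h a b)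
  · have h1 : {a | t < φ a} = ∅ := by
      ext a; simpa using (hφ1 a).trans ht
    have h2 : {a | t < ψ a} = ∅ := by
      ext a; simpa using (hψ1 a).trans ht
    simp [h1, h2]

/-- One-dimensional Prékopa–Leindler inequality for bounded functions, with equal weights. -/
theorem integral_mul_integral_le_sq_of_mul_le_sq {φ ψ H : ℝ → ℝ} (hφ : Measurable φ)
    (hψ : Measurable ψ) (hφ0 : ∀ x, 0 ≤ φ x) (hψ0 : ∀ x, 0 ≤ ψ x)
    (hH0 : ∀ x, 0 ≤ H x) (hφb : BddAbove (Set.range φ)) (hψb : BddAbove (Set.range ψ))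
    (hφi : Integrable φ) (hψi : Integrable ψ) (hHm : Measurable H) (hH : Integrable H)
    (h : ∀ x y, φ x * ψ y ≤ H ((x + y) / 2) ^ 2) :
    (∫ x, φ x) * ∫ x, ψ x ≤ (∫ x, H x) ^ 2 := by
  set α := ⨆ x, φ x
  set β := ⨆ x, ψ x
  have hα : ∀ x, φ x ≤ α := le_ciSup hφb
  have hβ : ∀ x, ψ x ≤ β := le_ciSup hψb
  rcases ((hφ0 0).trans (hα 0)).eq_or_lt with hα0 | hα0
  · have : φ = fun _ => 0 := funext fun x => le_antisymm (hα0 ▸ hα x) (hφ0 x)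
    simp [this, sq_nonneg]
  rcases ((hψ0 0).trans (hβ 0)).eq_or_lt with hβ0 | hβ0
  · have : ψ = fun _ => 0 := funext fun x => le_antisymm (hβ0 ▸ hβ x) (hψ0 x)
    simp [this, sq_nonneg]
  set c := √(α * β)
  have hc : 0 < c := Real.sqrt_pos.2 (mul_pos hα0 hβ0)
  have hc2 : c ^ 2 = α * β := Real.sq_sqrt (mul_pos hα0 hβ0).le
  have key := lintegral_add_lintegral_le_of_min_le (φ := fun x => φ x / α)
    (ψ := fun x => ψ x / β) (H := fun x => H (x / 2) / c) (hφ.div_const _) (hψ.div_const _)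
    ((hHm.comp (measurable_id.div_const 2)).div_const _) (fun x => div_nonneg (hφ0 x) hα0.le)
    (fun x => div_nonneg (hψ0 x) hβ0.le) (fun x => div_nonneg (hH0 _) hc.le)
    (fun x => (div_le_one hα0).2 (hα x)) (fun x => (div_le_one hβ0).2 (hβ x))
    (fun r hr => by
      obtain ⟨x, hx⟩ := exists_lt_of_lt_ciSup (f := φ) (b := r * α)
        (show r * α < α by nlinarith)
      exact ⟨x, (lt_div_iff₀ hα0).2 hx⟩)
    (fun r hr => by
      obtain ⟨x, hx⟩ := exists_lt_of_lt_ciSup (f := ψ) (b := r * β)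
        (show r * β < β by nlinarith)
      exact ⟨x, (lt_div_iff₀ hβ0).2 hx⟩)
    (fun x y => by
      refine abs_le_of_sq_le_sq' ?_ (div_nonneg (hH0 _) hc.le) |>.2
      have hx := div_nonneg (hφ0 x) hα0.le
      have hy := div_nonneg (hψ0 y) hβ0.le
      calc min (φ x / α) (ψ y / β) ^ 2 ≤ (φ x / α) * (ψ y / β) := by
            rw [sq]
            exact mul_le_mul (min_le_left _ _) (min_le_right _ _) (le_min hx hy) hx
        _ = φ x * ψ y / c ^ 2 := by rw [hc2]; field_simp
        _ ≤ (H ((x + y) / 2) / c) ^ 2 := by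
            rw [div_pow]; gcongr; exact h x y)
  have hHi : Integrable fun x => H (x / 2) / c := (hH.comp_div two_ne_zero).div_const c
  rw [← ofReal_integral_eq_lintegral_ofReal (hφi.div_const α)
      (ae_of_all _ fun x => div_nonneg (hφ0 x) hα0.le),
    ← ofReal_integral_eq_lintegral_ofReal (hψi.div_const β)
      (ae_of_all _ fun x => div_nonneg (hψ0 x) hβ0.le),
    ← ofReal_integral_eq_lintegral_ofReal hHi (ae_of_all _ fun x => div_nonneg (hH0 _) hc.le),
    ← ENNReal.ofReal_add (integral_nonneg fun x => div_nonneg (hφ0 x) hα0.le)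
      (integral_nonneg fun x => div_nonneg (hψ0 x) hβ0.le),
    ENNReal.ofReal_le_ofReal_iff (integral_nonneg fun x => div_nonneg (hH0 _) hc.le),
    integral_div, integral_div, integral_div, Measure.integral_comp_div H 2] at key
  have hI : 0 ≤ ∫ x, φ x := integral_nonneg hφ0
  have hJ : 0 ≤ ∫ x, ψ x := integral_nonneg hψ0
  simp only [Nat.abs_ofNat, smul_eq_mul] at key
  have hsq : (∫ x, φ x) / α * ((∫ x, ψ x) / β) ≤ ((∫ x, H x) / c) ^ 2 := by
    have h1 : 0 ≤ (∫ x, φ x) / α := by positivity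
    have h2 : 0 ≤ (∫ x, ψ x) / β := by positivity
    have h3 : 2 * (∫ x, H x) / c = 2 * ((∫ x, H x) / c) := by ring
    rw [h3] at key
    nlinarith [sq_nonneg ((∫ x, φ x) / α - (∫ x, ψ x) / β)]
  rwa [div_mul_div_comm, div_pow, hc2, div_le_div_iff_of_pos_right (mul_pos hα0 hβ0)] at hsq

/-- If `f(s) g(t) ≤ C e^{-st}` for `s, t > 0`, then `∫₀^∞ f ∫₀^∞ g ≤ C π / 2`. -/
theorem integral_Ioi_mul_integral_Ioi_le {f g : ℝ → ℝ} {C : ℝ} (hC : 0 ≤ C) (hf : Measurable f)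
    (hg : Measurable g) (hf0 : ∀ x, 0 ≤ f x) (hg0 : ∀ x, 0 ≤ g x)
    (hfi : Integrable f) (hgi : Integrable g)
    (hfb : ∃ M, ∀ x, 0 < x → x * f x ≤ M) (hgb : ∃ M, ∀ x, 0 < x → x * g x ≤ M)
    (h : ∀ s t, 0 < s → 0 < t → f s * g t ≤ C * exp (-(s * t))) :
    (∫ s in Set.Ioi 0, f s) * ∫ t in Set.Ioi 0, g t ≤ C * (π / 2) := by
  have himage : Real.exp '' Set.univ = Set.Ioi 0 := by rw [Set.image_univ, Real.range_exp]
  have hderiv : ∀ x ∈ Set.univ, HasDerivWithinAt Real.exp (Real.exp x) Set.univ x :=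
    fun x _ => (Real.hasDerivAt_exp x).hasDerivWithinAt
  have cov : ∀ k : ℝ → ℝ, ∫ s in Set.Ioi 0, k s = ∫ a, exp a * k (exp a) := by
    intro k
    rw [← himage, integral_image_eq_integral_abs_deriv_smul MeasurableSet.univ hderiv
      Real.exp_injective.injOn]
    simp
  have covi : ∀ k : ℝ → ℝ, IntegrableOn k (Set.Ioi 0) → Integrable fun a => exp a * k (exp a) := by
    intro k hk
    rw [← himage, integrableOn_image_iff_integrableOn_abs_deriv_smul MeasurableSet.univ hderiv
      Real.exp_injective.injOn] at hk
    simpa using hk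
  set k : ℝ → ℝ := fun r => √C * exp (-(1 / 2) * r ^ 2)
  have hk : Integrable k := (integrable_exp_neg_mul_sq (by norm_num)).const_mul _
  have hkint : (∫ s in Set.Ioi 0, k s) ^ 2 = C * (π / 2) := by
    simp only [k]
    rw [integral_const_mul, integral_gaussian_Ioi, mul_pow, Real.sq_sqrt hC, div_pow,
      Real.sq_sqrt (by positivity)]
    ring
  rw [← hkint, cov f, cov g, cov k]
  obtain ⟨M, hM⟩ := hfb
  obtain ⟨N, hN⟩ := hgb
  have hkm : Measurable k := by fun_prop
  refine integral_mul_integral_le_sq_of_mul_le_sq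
    (measurable_exp.mul (hf.comp measurable_exp)) (measurable_exp.mul (hg.comp measurable_exp))
    (fun x => mul_nonneg (exp_pos _).le (hf0 _)) (fun x => mul_nonneg (exp_pos _).le (hg0 _))
    (fun x => by positivity) ⟨M, by rintro _ ⟨a, rfl⟩; exact hM _ (exp_pos a)⟩
    ⟨N, by rintro _ ⟨a, rfl⟩; exact hN _ (exp_pos a)⟩ (covi f hfi.integrableOn)
    (covi g hgi.integrableOn) (measurable_exp.mul (hkm.comp measurable_exp))
    (covi k hk.integrableOn) fun x y => ?_
  calc exp x * f (exp x) * (exp y * g (exp y)) = exp x * exp y * (f (exp x) * g (exp y)) := by ring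
    _ ≤ exp x * exp y * (C * exp (-(exp x * exp y))) := by
        exact mul_le_mul_of_nonneg_left (h _ _ (exp_pos x) (exp_pos y)) (by positivity)
    _ = (exp ((x + y) / 2) * k (exp ((x + y) / 2))) ^ 2 := by
        simp only [k]
        have h1 : exp ((x + y) / 2) ^ 2 = exp x * exp y := by
          rw [← exp_nat_mul, ← exp_add]; congr 1; push_cast; ring
        rw [mul_pow, mul_pow, Real.sq_sqrt hC, h1, ← exp_nat_mul]
        congr 3
        push_cast; ring

/-- A nonnegative bounded measurable function with bounded support. -/
structure IsTestDensity {V : Type*} [NormedAddCommGroup V] [MeasurableSpace V] (f : V → ℝ) :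
    Prop where
  measurable : Measurable f
  nonneg : ∀ x, 0 ≤ f x
  bounded : ∃ M, ∀ x, f x ≤ M
  support : ∃ R, ∀ x, f x ≠ 0 → ‖x‖ ≤ R

namespace IsTestDensity

variable {V : Type*} [NormedAddCommGroup V] [MeasurableSpace V] [ProperSpace V] {f : V → ℝ}

theorem integrable (hf : IsTestDensity f) (μ : Measure V) [IsFiniteMeasureOnCompacts μ] :
    Integrable f μ := by
  obtain ⟨M, hM⟩ := hf.bounded
  obtain ⟨R, hR⟩ := hf.support
  have hsub : Function.support f ⊆ Metric.closedBall 0 R := fun x hx => by simpa using hR x hx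
  rw [← integrableOn_iff_integrable_of_support_subset hsub]
  refine Measure.integrableOn_of_bounded (M := M)
    (isCompact_closedBall (0 : V) R).measure_lt_top.ne hf.measurable.aestronglyMeasurable ?_
  exact ae_of_all _ fun x => by rw [Real.norm_of_nonneg (hf.nonneg x)]; exact hM x

theorem continuous_mul [BorelSpace V] (hf : IsTestDensity f) {h : V → ℝ} (hh : Continuous h)
    (hh0 : ∀ x, 0 ≤ h x) : IsTestDensity fun x => h x * f x := by
  obtain ⟨M, hM⟩ := hf.bounded
  obtain ⟨R, hR⟩ := hf.support
  obtain ⟨C, hC⟩ := (isCompact_closedBall (0 : V) R).exists_bound_of_continuousOn hh.continuousOn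
  refine ⟨hh.measurable.mul hf.measurable, fun x => mul_nonneg (hh0 x) (hf.nonneg x),
    ⟨|C| * |M|, fun x => ?_⟩, R, fun x hx => hR x (right_ne_zero_of_mul hx)⟩
  by_cases hx : f x = 0
  · rw [hx, mul_zero]; positivity
  · exact mul_le_mul ((le_abs_self _).trans ((hC x (by simpa using hR x hx)).trans (le_abs_self C)))
      ((hM x).trans (le_abs_self M)) (hf.nonneg x) (abs_nonneg C)

theorem const_mul [BorelSpace V] (hf : IsTestDensity f) {c : ℝ} (hc : 0 ≤ c) :
    IsTestDensity fun x => c * f x :=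
  hf.continuous_mul continuous_const fun _ => hc

theorem integrable_continuous_mul [BorelSpace V] (hf : IsTestDensity f) (μ : Measure V)
    [IsFiniteMeasureOnCompacts μ] {h : V → ℝ} (hh : Continuous h) :
    Integrable (fun x => h x * f x) μ := by
  refine ((hf.continuous_mul hh.abs fun x => abs_nonneg (h x)).integrable μ).mono
    (hh.measurable.mul hf.measurable).aestronglyMeasurable (ae_of_all _ fun x => ?_)
  simp

theorem comp_homeomorph [BorelSpace V] {W : Type*} [NormedAddCommGroup W] [MeasurableSpace W]
    [BorelSpace W] (hf : IsTestDensity f) (e : W ≃ₜ V) : IsTestDensity fun x => f (e x) := by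
  obtain ⟨M, hM⟩ := hf.bounded
  obtain ⟨R, hR⟩ := hf.support
  obtain ⟨C, hC⟩ := ((isCompact_closedBall (0 : V) R).image e.symm.continuous).isBounded
    |>.exists_norm_le
  refine ⟨hf.measurable.comp e.continuous.measurable, fun x => hf.nonneg _, ⟨M, fun x => hM _⟩,
    C, fun x hx => hC x ⟨e x, by simpa using hR _ hx, by simp⟩⟩

end IsTestDensity

section Product

variable {V : Type*} [MeasureSpace V]

theorem IsTestDensity.slice [NormedAddCommGroup V] {f : ℝ × V → ℝ} (hf : IsTestDensity f) (y : V) :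
    IsTestDensity fun s => f (s, y) := by
  obtain ⟨M, hM⟩ := hf.bounded
  obtain ⟨R, hR⟩ := hf.support
  exact ⟨hf.measurable.comp (measurable_id.prodMk measurable_const), fun s => hf.nonneg _,
    ⟨M, fun s => hM _⟩, R, fun s hs => (norm_fst_le (s, y)).trans (hR _ hs)⟩

theorem IsTestDensity.halfMarginal [NormedAddCommGroup V] {f : ℝ × V → ℝ}
    (hf : IsTestDensity f) :
    IsTestDensity fun y => ∫ s in Set.Ioi 0, f (s, y) := by
  obtain ⟨M, hM⟩ := hf.bounded
  obtain ⟨R, hR⟩ := hf.support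
  have hM0 : 0 ≤ M := (hf.nonneg 0).trans (hM 0)
  refine ⟨?_, fun y => setIntegral_nonneg measurableSet_Ioi fun s _ => hf.nonneg _,
    ⟨∫ s, (Set.Icc (-R) R).indicator (fun _ => M) s, fun y => ?_⟩, R, fun y hy => ?_⟩
  · have := hf.measurable.stronglyMeasurable.integral_prod_left'
      (μ := volume.restrict (Set.Ioi (0 : ℝ)))
    exact this.measurable
  · refine (setIntegral_le_integral ((hf.slice y).integrable _)
      (ae_of_all _ fun s => hf.nonneg _)).trans ?_
    refine integral_mono ((hf.slice y).integrable _) ?_ fun s => ?_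
    · exact (integrable_indicator_iff measurableSet_Icc).2 (integrableOn_const (by simp))
    · by_cases hs : f (s, y) = 0
      · simp only [hs]; exact Set.indicator_nonneg (fun _ _ => hM0) s
      · have := (norm_fst_le (s, y)).trans (hR _ hs)
        rw [Set.indicator_of_mem (by simpa [abs_le] using this)]
        exact hM _
  · by_contra hyR
    refine hy (integral_eq_zero_of_ae (ae_of_all _ fun s => ?_))
    by_contra hs
    exact hyR ((norm_snd_le (s, y)).trans (hR _ hs))

variable [SFinite (volume : Measure V)]

theorem setIntegral_fst_pos {h : ℝ × V → ℝ} (hh : Integrable h) :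
    ∫ p in {p : ℝ × V | 0 < p.1}, h p = ∫ y, ∫ s in Set.Ioi 0, h (s, y) := by
  have hset : {p : ℝ × V | 0 < p.1} = Set.Ioi 0 ×ˢ Set.univ := by ext; simp
  have hres : (volume : Measure (ℝ × V)).restrict {p : ℝ × V | 0 < p.1}
      = (volume.restrict (Set.Ioi (0 : ℝ))).prod volume := by
    rw [hset, Measure.volume_eq_prod, ← Measure.prod_restrict, Measure.restrict_univ]
  rw [hres, integral_prod_symm]
  rw [← hres]
  exact hh.integrableOn

theorem integral_eq_setIntegral_fst_gt_add_lt {h : ℝ × V → ℝ} (hh : Integrable h) (m : ℝ) :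
    ∫ p, h p = (∫ p in {p : ℝ × V | m < p.1}, h p) + ∫ p in {p : ℝ × V | p.1 < m}, h p := by
  have hm : MeasurableSet {p : ℝ × V | m < p.1} := measurableSet_lt measurable_const measurable_fst
  rw [← integral_add_compl hm hh]
  congr 1
  refine setIntegral_congr_set ?_
  have hnull : (volume : Measure (ℝ × V)) {p | p.1 = m} = 0 := by
    have : {p : ℝ × V | p.1 = m} = {m} ×ˢ Set.univ := by ext; simp
    rw [this, Measure.volume_eq_prod, Measure.prod_prod]; simp
  filter_upwards [compl_mem_ae_iff.2 hnull] with p hp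
  simp only [eq_iff_iff]
  change (¬ m < p.1) ↔ p.1 < m
  rw [not_lt]
  exact ⟨fun h => lt_of_le_of_ne h hp, le_of_lt⟩

theorem setIntegral_fst_gt {h : ℝ × V → ℝ} (hh : Integrable h) (m : ℝ) :
    ∫ p in {p : ℝ × V | m < p.1}, h p = ∫ s in Set.Ioi m, ∫ y, h (s, y) := by
  have hset : {p : ℝ × V | m < p.1} = Set.Ioi m ×ˢ Set.univ := by ext; simp
  rw [hset, Measure.volume_eq_prod, setIntegral_prod _ hh.integrableOn, Measure.restrict_univ]

/-- Some hyperplane orthogonal to the first axis halves an integrable function. -/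
theorem exists_setIntegral_fst_gt_eq_lt {h : ℝ × V → ℝ} (hh : Integrable h)
    (hpos : 0 < ∫ p, h p) :
    ∃ m : ℝ, ∫ p in {p : ℝ × V | m < p.1}, h p = ∫ p in {p : ℝ × V | p.1 < m}, h p := by
  set k : ℝ → ℝ := fun s => ∫ y, h (s, y)
  have hk : Integrable k := hh.integral_prod_left
  have hI : ∫ p, h p = ∫ s, k s := integral_prod h hh
  have hsplit : (∫ s in Set.Iic 0, k s) + ∫ s in Set.Ioi 0, k s = ∫ s, k s :=
    intervalIntegral.integral_Iic_add_Ioi hk.integrableOn hk.integrableOn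
  have htop := intervalIntegral_tendsto_integral_Ioi 0 hk.integrableOn Filter.tendsto_id
  have hbot := (intervalIntegral_tendsto_integral_Iic 0 hk.integrableOn Filter.tendsto_id).neg
  simp only [id, ← intervalIntegral.integral_symm] at htop hbot
  obtain ⟨u, hu⟩ := (htop.eventually_const_le (u := (∫ s in Set.Ioi 0, k s) - (∫ s, k s) / 2)
    (by linarith)).exists
  obtain ⟨l, hl⟩ := (hbot.eventually_le_const (u := (∫ s in Set.Ioi 0, k s) - (∫ s, k s) / 2)
    (by linarith)).exists
  obtain ⟨m, hm⟩ := mem_range_of_exists_le_of_exists_ge (hk.continuous_primitive 0)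
    ⟨l, hl⟩ ⟨u, hu⟩
  have hm' := intervalIntegral.integral_interval_add_Ioi (a := 0) (b := m) hk.integrableOn
    hk.integrableOn
  have hgt := setIntegral_fst_gt hh m
  have := integral_eq_setIntegral_fst_gt_add_lt hh m
  exact ⟨m, by linarith⟩

end Product

/-- The Santaló inequality in dimension `d` for a pair of test densities, the second being
centered. -/
def SantaloInequality (d : ℕ) : Prop :=
  ∀ f g : (Fin d → ℝ) → ℝ, IsTestDensity f → IsTestDensity g →
    (∀ x y, f x * g y ≤ exp (-(x ⬝ᵥ y))) → (∀ i, ∫ x, x i * g x = 0) →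
    (∫ x, f x) * ∫ x, g x ≤ (2 * π) ^ d

section Induction

variable {d : ℕ} {f g : ℝ × (Fin d → ℝ) → ℝ}

theorem SantaloInequality.setIntegral_pos_mul_le (hd : SantaloInequality d)
    (hf : IsTestDensity f) (hg : IsTestDensity g)
    (hfg : ∀ p q, 0 < p.1 → 0 < q.1 → f p * g q ≤ exp (-(p.1 * q.1 + p.2 ⬝ᵥ q.2)))
    (hf_bary : ∀ i, ∫ p in {p : ℝ × (Fin d → ℝ) | 0 < p.1}, p.2 i * f p = 0) :
    (∫ p in {p : ℝ × (Fin d → ℝ) | 0 < p.1}, f p) *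
      ∫ p in {p : ℝ × (Fin d → ℝ) | 0 < p.1}, g p ≤ π / 2 * (2 * π) ^ d := by
  rw [setIntegral_fst_pos (hf.integrable _), setIntegral_fst_pos (hg.integrable _)]
  have hbound : ∀ {k : ℝ × (Fin d → ℝ) → ℝ}, IsTestDensity k → ∀ y,
      ∃ M, ∀ s, 0 < s → s * k (s, y) ≤ M := by
    intro k hk y
    obtain ⟨M, hM⟩ := ((hk.slice y).continuous_mul continuous_abs abs_nonneg).bounded
    exact ⟨M, fun s hs => by simpa [abs_of_pos hs] using hM s⟩
  have hF := hf.halfMarginal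
  have hG := hg.halfMarginal.const_mul (c := 2 / π) (by positivity)
  have key := hd _ _ hG hF (fun y x => ?_) (fun i => ?_)
  · rw [integral_const_mul] at key
    have := mul_le_mul_of_nonneg_left key (show 0 ≤ π / 2 by positivity)
    refine le_trans (le_of_eq ?_) this
    field_simp
  · have := integral_Ioi_mul_integral_Ioi_le (C := exp (-(x ⬝ᵥ y))) (exp_pos _).le
      (hf.slice x).measurable (hg.slice y).measurable (hf.slice x).nonneg (hg.slice y).nonneg
      ((hf.slice x).integrable _) ((hg.slice y).integrable _) (hbound hf x) (hbound hg y)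
      (fun s t hs ht => (hfg (s, x) (t, y) hs ht).trans_eq (by
        rw [← exp_add]; congr 1; simp only; ring))
    rw [dotProduct_comm]
    calc 2 / π * (∫ s in Set.Ioi 0, g (s, y)) * ∫ s in Set.Ioi 0, f (s, x)
        = 2 / π * ((∫ s in Set.Ioi 0, f (s, x)) * ∫ s in Set.Ioi 0, g (s, y)) := by ring
      _ ≤ 2 / π * (exp (-(x ⬝ᵥ y)) * (π / 2)) := by gcongr
      _ = exp (-(x ⬝ᵥ y)) := by field_simp
  · have := hf_bary i
    rw [setIntegral_fst_pos (hf.integrable_continuous_mul _ (by fun_prop))] at this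
    simpa only [integral_const_mul] using this

/-- The reflection of `ℝ × V` in the first coordinate. -/
def negFst (V : Type*) [TopologicalSpace V] : ℝ × V ≃ₜ ℝ × V :=
  (Homeomorph.neg ℝ).prodCongr (Homeomorph.refl V)

theorem setIntegral_fst_neg_eq (h : ℝ × (Fin d → ℝ) → ℝ) :
    ∫ p in {p : ℝ × (Fin d → ℝ) | p.1 < 0}, h p =
      ∫ p in {p : ℝ × (Fin d → ℝ) | 0 < p.1}, h (negFst _ p) := by
  have hmp : MeasurePreserving (negFst (Fin d → ℝ)) :=
    (Measure.measurePreserving_neg volume).prod (MeasurePreserving.id volume)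
  rw [← hmp.setIntegral_preimage_emb (negFst _).measurableEmbedding]
  congr 2
  ext p
  simp [negFst]

theorem SantaloInequality.integral_mul_le_of_halves_centered (hd : SantaloInequality d)
    (hf : IsTestDensity f) (hg : IsTestDensity g)
    (hfg : ∀ p q, f p * g q ≤ exp (-(p.1 * q.1 + p.2 ⬝ᵥ q.2)))
    (hf_half : ∫ p in {p : ℝ × (Fin d → ℝ) | 0 < p.1}, f p =
      ∫ p in {p : ℝ × (Fin d → ℝ) | p.1 < 0}, f p)
    (hf_pos : ∀ i, ∫ p in {p : ℝ × (Fin d → ℝ) | 0 < p.1}, p.2 i * f p = 0)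
    (hf_neg : ∀ i, ∫ p in {p : ℝ × (Fin d → ℝ) | p.1 < 0}, p.2 i * f p = 0) :
    (∫ p, f p) * ∫ p, g p ≤ (2 * π) ^ (d + 1) := by
  have hpos := hd.setIntegral_pos_mul_le hf hg (fun p q _ _ => hfg p q) hf_pos
  have hneg := hd.setIntegral_pos_mul_le (hf.comp_homeomorph (negFst _))
    (hg.comp_homeomorph (negFst _)) (fun p q _ _ => (hfg _ _).trans_eq (by simp [negFst]))
    (fun i => (setIntegral_fst_neg_eq fun p => p.2 i * f p).symm.trans (hf_neg i))
  rw [← setIntegral_fst_neg_eq, ← setIntegral_fst_neg_eq, ← hf_half] at hneg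
  rw [integral_eq_setIntegral_fst_gt_add_lt (hf.integrable _) 0,
    integral_eq_setIntegral_fst_gt_add_lt (hg.integrable _) 0, ← hf_half, pow_succ]
  linarith

/-- The affine map `(s, y) ↦ (s + m, y + s w + a)`. -/
def affineShear (m : ℝ) (w a : Fin d → ℝ) : ℝ × (Fin d → ℝ) ≃ₜ ℝ × (Fin d → ℝ) where
  toFun p := (p.1 + m, p.2 + p.1 • w + a)
  invFun p := (p.1 - m, p.2 - (p.1 - m) • w - a)
  left_inv p := Prod.ext (by simp) (by simp only [add_sub_cancel_right]; abel)
  right_inv p := Prod.ext (by simp) (by simp only; abel)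
  continuous_toFun := by fun_prop
  continuous_invFun := by fun_prop

theorem measurePreserving_affineShear (m : ℝ) (w a : Fin d → ℝ) :
    MeasurePreserving (affineShear m w a) := by
  refine (measurePreserving_add_right volume m).skew_product
    (g := fun s y => y + s • w + a) (by unfold Function.uncurry; fun_prop) (ae_of_all _ fun s => ?_)
  simp only [add_assoc]
  exact (measurePreserving_add_right volume (s • w + a)).map_eq

/-- The linear shear `(t, y) ↦ (t - ⟨w, y⟩, y)`. -/
def dualShear (w : Fin d → ℝ) : ℝ × (Fin d → ℝ) ≃ₜ ℝ × (Fin d → ℝ) where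
  toFun p := (p.1 - w ⬝ᵥ p.2, p.2)
  invFun p := (p.1 + w ⬝ᵥ p.2, p.2)
  left_inv p := by ext <;> simp
  right_inv p := by ext <;> simp
  continuous_toFun := by fun_prop
  continuous_invFun := by fun_prop

theorem measurePreserving_dualShear (w : Fin d → ℝ) : MeasurePreserving (dualShear w) := by
  have h : MeasurePreserving (fun p : (Fin d → ℝ) × ℝ => (p.1, p.2 - w ⬝ᵥ p.1)) :=
    (MeasurePreserving.id volume).skew_product (g := fun y t => t - w ⬝ᵥ y)
      (by unfold Function.uncurry; fun_prop)
      (ae_of_all _ fun y => (measurePreserving_sub_right volume (w ⬝ᵥ y)).map_eq)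
  exact Measure.measurePreserving_swap.comp (h.comp Measure.measurePreserving_swap)

/-- After an affine shear, a test density has its two halves of equal mass and centered in the
remaining coordinates. -/
theorem IsTestDensity.exists_affineShear_centered (hf : IsTestDensity f) (hpos : 0 < ∫ p, f p) :
    ∃ (m : ℝ) (w a : Fin d → ℝ),
      (∫ p in {p : ℝ × (Fin d → ℝ) | 0 < p.1}, f (affineShear m w a p) =
        ∫ p in {p : ℝ × (Fin d → ℝ) | p.1 < 0}, f (affineShear m w a p)) ∧
      (∀ i, ∫ p in {p : ℝ × (Fin d → ℝ) | 0 < p.1}, p.2 i * f (affineShear m w a p) = 0) ∧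
      (∀ i, ∫ p in {p : ℝ × (Fin d → ℝ) | p.1 < 0}, p.2 i * f (affineShear m w a p) = 0) := by
  obtain ⟨m, hm⟩ := exists_setIntegral_fst_gt_eq_lt (hf.integrable volume) hpos
  set P := {p : ℝ × (Fin d → ℝ) | m < p.1} with hP
  set N := {p : ℝ × (Fin d → ℝ) | p.1 < m} with hN
  set A := ∫ p in P, f p with hA
  have hApos : 0 < A := by
    have := integral_eq_setIntegral_fst_gt_add_lt (hf.integrable volume) m
    linarith
  set βP := ∫ p in P, (p.1 - m) * f p with hβP
  set βN := ∫ p in N, (p.1 - m) * f p with hβN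
  have hβ : 0 < βP - βN := by
    have hPm : MeasurableSet P := measurableSet_lt measurable_const measurable_fst
    have hNm : MeasurableSet N := measurableSet_lt measurable_fst measurable_const
    have hβN0 : βN ≤ 0 := setIntegral_nonpos hNm fun p hp =>
      mul_nonpos_of_nonpos_of_nonneg (sub_nonpos.2 (le_of_lt hp)) (hf.nonneg p)
    have hβP0 : 0 < βP := by
      rw [hA, setIntegral_pos_iff_support_of_nonneg_ae (ae_of_all _ hf.nonneg)
        (hf.integrable _).integrableOn] at hApos
      rw [hβP, setIntegral_pos_iff_support_of_nonneg_ae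
        (ae_restrict_of_forall_mem hPm fun p hp =>
          mul_nonneg (sub_nonneg.2 (le_of_lt hp)) (hf.nonneg p))
        (hf.integrable_continuous_mul _ (by fun_prop))]
      refine hApos.trans_le (measure_mono fun p hp => ⟨?_, hp.2⟩)
      exact mul_ne_zero (sub_ne_zero.2 (ne_of_gt hp.2)) hp.1
    linarith
  set w : Fin d → ℝ := fun i =>
    ((∫ p in P, p.2 i * f p) - ∫ p in N, p.2 i * f p) / (βP - βN) with hw
  set a : Fin d → ℝ := fun i => ((∫ p in P, p.2 i * f p) - βP * w i) / A with ha
  have hpreP : affineShear m w a ⁻¹' P = {p : ℝ × (Fin d → ℝ) | 0 < p.1} := by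
    ext p; simp [affineShear, hP]
  have hpreN : affineShear m w a ⁻¹' N = {p : ℝ × (Fin d → ℝ) | p.1 < 0} := by
    ext p; simp [affineShear, hN]
  have cov : ∀ (h : ℝ × (Fin d → ℝ) → ℝ) (S : Set (ℝ × (Fin d → ℝ))),
      ∫ p in affineShear m w a ⁻¹' S, h (affineShear m w a p) = ∫ p in S, h p := fun h S =>
    (measurePreserving_affineShear m w a).setIntegral_preimage_emb
      (affineShear m w a).measurableEmbedding h S
  have moment : ∀ (i : Fin d) (S : Set (ℝ × (Fin d → ℝ))),
      ∫ p in affineShear m w a ⁻¹' S, p.2 i * f (affineShear m w a p) =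
        (∫ p in S, p.2 i * f p) - (∫ p in S, (p.1 - m) * f p) * w i - a i * ∫ p in S, f p := by
    intro i S
    have h1 := hf.integrable_continuous_mul (volume.restrict S) (h := fun p => p.2 i) (by fun_prop)
    have h2 := hf.integrable_continuous_mul (volume.restrict S) (h := fun p => p.1 - m)
      (by fun_prop)
    have h3 := hf.integrable (volume.restrict S)
    rw [← integral_mul_const, ← integral_const_mul, ← integral_sub h1 (h2.mul_const _),
      ← integral_sub (by exact h1.sub (h2.mul_const _)) (h3.const_mul _),
      ← cov _ S]
    congr 1
    ext p
    simp [affineShear]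
    ring
  refine ⟨m, w, a, ?_, fun i => ?_, fun i => ?_⟩
  · rw [← hpreP, ← hpreN, cov, cov, ← hA, hm]
  · rw [← hpreP, moment, ← hβP, ← hA]
    simp only [ha]
    field_simp
    ring
  · rw [← hpreN, moment, ← hβN, ← hm]
    simp only [ha]
    have : w i * (βP - βN) = (∫ p in P, p.2 i * f p) - ∫ p in N, p.2 i * f p := by
      simp only [hw]; field_simp
    field_simp
    linarith

theorem SantaloInequality.integral_prod_mul_le (hd : SantaloInequality d)
    (hf : IsTestDensity f) (hg : IsTestDensity g)
    (hfg : ∀ p q, f p * g q ≤ exp (-(p.1 * q.1 + p.2 ⬝ᵥ q.2)))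
    (hg_fst : ∫ q, q.1 * g q = 0) (hg_snd : ∀ i, ∫ q, q.2 i * g q = 0) :
    (∫ p, f p) * ∫ p, g p ≤ (2 * π) ^ (d + 1) := by
  rcases (show 0 ≤ ∫ p, f p from integral_nonneg hf.nonneg).eq_or_lt with h0 | hpos
  · rw [← h0, zero_mul]; positivity
  obtain ⟨m, w, a, hhalf, hP, hN⟩ := hf.exists_affineShear_centered hpos
  set k : ℝ × (Fin d → ℝ) → ℝ := fun q => exp (m * q.1 + a ⬝ᵥ q.2) * g q with hk
  have hkt : IsTestDensity k := hg.continuous_mul (by fun_prop) fun q => (exp_pos _).le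
  have key := hd.integral_mul_le_of_halves_centered (hf.comp_homeomorph (affineShear m w a))
    (hkt.comp_homeomorph (dualShear w)) (fun p q => ?_) hhalf hP hN
  · rw [(measurePreserving_affineShear m w a).integral_comp
        (affineShear m w a).measurableEmbedding,
      (measurePreserving_dualShear w).integral_comp (dualShear w).measurableEmbedding] at key
    refine le_trans (mul_le_mul_of_nonneg_left ?_ hpos.le) key
    have h1 := (hg.integrable_continuous_mul volume continuous_fst).const_mul m
    have h2 : ∀ i ∈ Finset.univ, Integrable fun q : ℝ × (Fin d → ℝ) => a i * (q.2 i * g q) :=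
      fun i _ => (hg.integrable_continuous_mul volume (h := fun q => q.2 i)
        (by fun_prop)).const_mul (a i)
    have htilt : ∫ q, (g q + (m * (q.1 * g q) + ∑ i, a i * (q.2 i * g q))) = ∫ q, g q := by
      rw [integral_add (hg.integrable _) (by exact h1.add (integrable_finsetSum _ h2)),
        integral_add h1 (integrable_finsetSum _ h2), integral_finsetSum _ h2]
      simp [integral_const_mul, hg_fst, hg_snd]
    rw [← htilt]
    refine integral_mono ((hg.integrable _).add (h1.add (integrable_finsetSum _ h2)))
      (hkt.integrable _) fun q => ?_
    calc g q + (m * (q.1 * g q) + ∑ i, a i * (q.2 i * g q))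
        = (m * q.1 + a ⬝ᵥ q.2 + 1) * g q := by
          simp only [dotProduct, add_mul, Finset.sum_mul]
          simp only [mul_assoc]
          ring
      _ ≤ exp (m * q.1 + a ⬝ᵥ q.2) * g q :=
          mul_le_mul_of_nonneg_right (add_one_le_exp _) (hg.nonneg q)
  · calc f (affineShear m w a p) * k (dualShear w q)
        = exp (m * (dualShear w q).1 + a ⬝ᵥ (dualShear w q).2) *
            (f (affineShear m w a p) * g (dualShear w q)) := by simp only [hk]; ring
      _ ≤ exp (m * (dualShear w q).1 + a ⬝ᵥ (dualShear w q).2) * _ :=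
          mul_le_mul_of_nonneg_left (hfg _ _) (exp_pos _).le
      _ = exp (-(p.1 * q.1 + p.2 ⬝ᵥ q.2)) := by
          rw [← exp_add]
          congr 1
          simp only [affineShear, dualShear, Homeomorph.homeomorph_mk_coe, Equiv.coe_fn_mk,
            add_dotProduct, smul_dotProduct, smul_eq_mul]
          ring

/-- The homeomorphism `(s, y) ↦ (s, y₀, …, y_{d-1})`. -/
def consHomeomorph (d : ℕ) : ℝ × (Fin d → ℝ) ≃ₜ (Fin (d + 1) → ℝ) where
  toFun p := Fin.cons p.1 p.2
  invFun x := (x 0, Fin.tail x)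
  left_inv p := by simp
  right_inv x := by simp
  continuous_toFun := Continuous.finCons (A := fun _ => ℝ) continuous_fst continuous_snd
  continuous_invFun := (continuous_apply 0).prodMk (continuous_pi fun i => continuous_apply i.succ)

theorem measurePreserving_consHomeomorph (d : ℕ) : MeasurePreserving (consHomeomorph d) := by
  have h := (volume_preserving_piFinSuccAbove (fun _ : Fin (d + 1) => ℝ) 0).symm
  convert h using 1
  ext p i
  simp [consHomeomorph]

end Induction

theorem santaloInequality (d : ℕ) : SantaloInequality d := by
  induction d with
  | zero =>
    intro f g hf hg hfg _
    have eval_zero : ∀ k : (Fin 0 → ℝ) → ℝ, ∫ x, k x = k 0 := fun k => by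
      rw [integral_unique, congrArg k (Subsingleton.elim _ (0 : Fin 0 → ℝ))]
      simp [Measure.real, volume_pi]
    rw [eval_zero, eval_zero]
    simpa using hfg 0 0
  | succ d ih =>
    intro f g hf hg hfg hbary
    have cov : ∀ h : (Fin (d + 1) → ℝ) → ℝ, ∫ p, h (consHomeomorph d p) = ∫ x, h x :=
      (measurePreserving_consHomeomorph d).integral_comp (consHomeomorph d).measurableEmbedding
    rw [← cov f, ← cov g]
    refine ih.integral_prod_mul_le (hf.comp_homeomorph _) (hg.comp_homeomorph _)
      (fun p q => (hfg _ _).trans_eq ?_) ?_ fun i => ?_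
    · simp [consHomeomorph, dotProduct, Fin.sum_univ_succ]
    · exact (cov fun x => x 0 * g x).trans (hbary 0)
    · exact (cov fun x => x i.succ * g x).trans (hbary i.succ)

theorem isTestDensity_indicator_closedBall {V : Type*} [NormedAddCommGroup V] [MeasurableSpace V]
    [OpensMeasurableSpace V] {F : V → ℝ} (hF : Measurable F) (hF0 : ∀ x, 0 ≤ F x) {R M : ℝ}
    (hM0 : 0 ≤ M) (hM : ∀ x, ‖x‖ ≤ R → F x ≤ M) :
    IsTestDensity ((Metric.closedBall 0 R).indicator F) := by
  refine ⟨hF.indicator measurableSet_closedBall, Set.indicator_nonneg fun x _ => hF0 x,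
    ⟨M, fun x => ?_⟩, R, fun x hx => by simpa using Set.mem_of_indicator_ne_zero hx⟩
  exact Set.indicator_apply_le' (fun hx => hM x (by simpa using hx)) fun _ => hM0

theorem lintegral_eq_iSup_closedBall {d : ℕ} (F : (Fin d → ℝ) → ℝ) :
    ∫⁻ x, ENNReal.ofReal (F x) =
      ⨆ n : ℕ, ∫⁻ x, ENNReal.ofReal ((Metric.closedBall 0 (n : ℝ)).indicator F x) := by
  have hind : ∀ (n : ℕ) x, ENNReal.ofReal ((Metric.closedBall 0 (n : ℝ)).indicator F x) =
      (Metric.closedBall 0 (n : ℝ)).indicator (fun x => ENNReal.ofReal (F x)) x := fun n x => by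
    by_cases hx : x ∈ Metric.closedBall 0 (n : ℝ) <;> simp [hx]
  have hmono : Monotone fun n : ℕ => Metric.closedBall (0 : Fin d → ℝ) (n : ℝ) :=
    fun m n hmn => Metric.closedBall_subset_closedBall (by exact_mod_cast hmn)
  simp only [hind, lintegral_indicator measurableSet_closedBall]
  rw [← setLIntegral_univ, ← Metric.iUnion_closedBall_nat (0 : Fin d → ℝ),
    setLIntegral_iUnion_of_directed _ hmono.directed_le]

/-- The functional Santaló inequality for an even, locally bounded function. -/
theorem lintegral_mul_lintegral_le_of_even {d : ℕ} {F G : (Fin d → ℝ) → ℝ} (hF : Measurable F)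
    (hG : Measurable G) (hF0 : ∀ x, 0 ≤ F x) (hG0 : ∀ x, 0 ≤ G x)
    (hFb : ∀ R, ∃ M, ∀ x, ‖x‖ ≤ R → F x ≤ M) (hGb : ∀ R, ∃ M, ∀ x, ‖x‖ ≤ R → G x ≤ M)
    (hF_even : ∀ x, F (-x) = F x) (hFG : ∀ x y, F x * G y ≤ exp (-(x ⬝ᵥ y))) :
    (∫⁻ x, ENNReal.ofReal (F x)) * ∫⁻ x, ENNReal.ofReal (G x) ≤ ENNReal.ofReal ((2 * π) ^ d) := by
  rw [lintegral_eq_iSup_closedBall F, lintegral_eq_iSup_closedBall G]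
  simp only [ENNReal.iSup_mul, ENNReal.mul_iSup]
  refine iSup₂_le fun m n => ?_
  obtain ⟨M, hM⟩ := hFb n
  obtain ⟨N, hN⟩ := hGb m
  have hFt := isTestDensity_indicator_closedBall hF hF0 (abs_nonneg M)
    fun x hx => (hM x hx).trans (le_abs_self M)
  have hGt := isTestDensity_indicator_closedBall hG hG0 (abs_nonneg N)
    fun x hx => (hN x hx).trans (le_abs_self N)
  rw [← ofReal_integral_eq_lintegral_ofReal (hFt.integrable _) (ae_of_all _ hFt.nonneg),
    ← ofReal_integral_eq_lintegral_ofReal (hGt.integrable _) (ae_of_all _ hGt.nonneg),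
    ← ENNReal.ofReal_mul (integral_nonneg hFt.nonneg), mul_comm (integral _ _)]
  refine ENNReal.ofReal_le_ofReal (santaloInequality d _ _ hGt hFt (fun x y => ?_) fun i => ?_)
  · rw [mul_comm, dotProduct_comm]
    refine le_trans (mul_le_mul ?_ ?_ (hGt.nonneg x) (hF0 y)) (hFG y x)
    · exact Set.indicator_le_self' (fun _ _ => hF0 _) y
    · exact Set.indicator_le_self' (fun _ _ => hG0 _) x
  · have hodd := integral_neg_eq_self
      (fun x : Fin d → ℝ => x i * (Metric.closedBall 0 (n : ℝ)).indicator F x) volume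
    have heven : ∀ x, (Metric.closedBall 0 (n : ℝ)).indicator F (-x) =
        (Metric.closedBall 0 (n : ℝ)).indicator F x := fun x => by
      simp [Set.indicator, hF_even]
    simp only [heven, Pi.neg_apply, neg_mul, integral_neg] at hodd
    linarith

theorem lintegral_stdGauss {d : ℕ} {h : EuclideanSpace ℝ (Fin d) → ℝ} (hh : Measurable h) :
    ∫⁻ x, ENNReal.ofReal (exp (h x)) ∂stdGauss d =
      ENNReal.ofReal ((2 * π) ^ (-(d : ℝ) / 2)) *
        ∫⁻ x : Fin d → ℝ,
          ENNReal.ofReal (exp (h (WithLp.toLp 2 x) - ‖WithLp.toLp 2 x‖ ^ 2 / 2)) := by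
  rw [stdGauss, lintegral_withDensity_eq_lintegral_mul _ (by fun_prop) (by fun_prop),
    ← lintegral_const_mul _ (by fun_prop),
    ← (PiLp.volume_preserving_toLp (Fin d)).lintegral_comp (by fun_prop)]
  refine lintegral_congr fun x => ?_
  simp only [Pi.mul_apply]
  rw [← ENNReal.ofReal_mul (by positivity), ← ENNReal.ofReal_mul (by positivity), mul_assoc,
    ← exp_add]
  ring_nf

section Hconv

variable {E : Type*} [NormedAddCommGroup E] {f : E → ℝ}

theorem bddBelow_range_Hconv (hf : BddBelow (Set.range f)) (x : E) :
    BddBelow (Set.range fun y => f (x + y) + ‖y‖ ^ 2 / 2) := by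
  obtain ⟨b, hb⟩ := hf
  refine ⟨b, ?_⟩
  rintro _ ⟨y, rfl⟩
  have := hb ⟨x + y, rfl⟩
  have := sq_nonneg ‖y‖
  simp only
  linarith

theorem Hconv_le (hf : BddBelow (Set.range f)) (x z : E) :
    Hconv f x ≤ f z + ‖z - x‖ ^ 2 / 2 := by
  have h := ciInf_le (bddBelow_range_Hconv hf x) (z - x)
  rwa [add_sub_cancel] at h

theorem measurable_Hconv [MeasurableSpace E] [BorelSpace E] (hf : Continuous f)
    (hf_bdd : BddBelow (Set.range f)) : Measurable (Hconv f) := by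
  refine UpperSemicontinuous.measurable ?_
  exact upperSemicontinuous_ciInf (bddBelow_range_Hconv hf_bdd) fun y =>
    Continuous.upperSemicontinuous (by fun_prop)

end Hconv

/-- Symmetric property (τ) for the Gaussian measure: if `f` is continuous, bounded
from below and even, then `(∫ e^{-f} dγ_d) (∫ e^{Hf} dγ_d) ≤ 1`. -/
theorem symmetric_tau_gaussian (d : ℕ) (f : EuclideanSpace ℝ (Fin d) → ℝ)
    (hf_cont : Continuous f) (hf_bdd : BddBelow (Set.range f))
    (hf_even : ∀ x, f (-x) = f x) :
    (∫⁻ x, ENNReal.ofReal (Real.exp (-f x)) ∂stdGauss d) *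
      (∫⁻ x, ENNReal.ofReal (Real.exp (Hconv f x)) ∂stdGauss d) ≤ 1 := by
  have hHm : Measurable (Hconv f) := measurable_Hconv hf_cont hf_bdd
  rw [lintegral_stdGauss (h := fun x => -f x) hf_cont.measurable.neg,
    lintegral_stdGauss hHm, mul_mul_mul_comm]
  have hc : (2 * π) ^ (-(d : ℝ) / 2) * (2 * π) ^ (-(d : ℝ) / 2) * (2 * π) ^ d = (1 : ℝ) := by
    rw [← rpow_natCast (2 * π) d, ← rpow_add (by positivity), ← rpow_add (by positivity)]
    ring_nf
    simp
  rw [← ENNReal.ofReal_one, ← hc, ENNReal.ofReal_mul (by positivity),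
    ENNReal.ofReal_mul (by positivity)]
  gcongr
  refine lintegral_mul_lintegral_le_of_even (by fun_prop) (by fun_prop) (fun x => (exp_pos _).le)
    (fun x => (exp_pos _).le) (fun R => ?_) (fun R => ?_) (fun x => ?_) fun x y => ?_
  · obtain ⟨b, hb⟩ := hf_bdd
    refine ⟨exp (-b), fun x _ => exp_le_exp.2 ?_⟩
    have := hb ⟨WithLp.toLp 2 x, rfl⟩
    have := sq_nonneg ‖WithLp.toLp 2 x‖
    linarith
  · refine ⟨exp (f 0), fun x _ => exp_le_exp.2 ?_⟩
    have := Hconv_le hf_bdd (WithLp.toLp 2 x) 0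
    rw [zero_sub, norm_neg] at this
    linarith
  · simp [WithLp.toLp_neg, hf_even]
  · rw [← exp_add, exp_le_exp]
    have h := Hconv_le hf_bdd (WithLp.toLp 2 y) (WithLp.toLp 2 x)
    rw [norm_sub_sq_real] at h
    have hin : inner ℝ (WithLp.toLp 2 x) (WithLp.toLp 2 y) = x ⬝ᵥ y := by
      simp [PiLp.inner_apply, dotProduct, mul_comm]
    rw [hin] at h
    linarith
end

section
/- For every C > 0 there exists a constant K, depending only on C, such that for every ε ∈ (0,1] and every even function f in the class F(C,ε), one has E[e^{-f(X)}] · E[e^{Hf(X)}] ≤ 1 + K ε³, where X is a standard Gaussian vector on ℝ^d. -/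
open MeasureTheory Real

/-- The class `F(C,ε)`: functions that are `Cε`-Lipschitz and satisfy
`f(x+h) + f(x-h) - 2f(x) ≤ Cε²|h|²` for all `x, h`. -/
def memF {E : Type*} [NormedAddCommGroup E] (C ε : ℝ) (f : E → ℝ) : Prop :=
  LipschitzWith (C * ε).toNNReal f ∧
    ∀ x h : E, f (x + h) + f (x - h) - 2 * f x ≤ C * ε ^ 2 * ‖h‖ ^ 2

open ProbabilityTheory Filter Topology
open scoped RealInnerProductSpace NNReal

theorem integral_stdGauss {F : Type*} [NormedAddCommGroup F] [NormedSpace ℝ F] (d : ℕ)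
    (g : EuclideanSpace ℝ (Fin d) → F) :
    ∫ x, g x ∂stdGauss d =
      ∫ x, ((2 * π) ^ (-(d : ℝ) / 2) * Real.exp (-‖x‖ ^ 2 / 2)) • g x := by
  rw [stdGauss, integral_withDensity_eq_integral_toReal_smul₀ (by fun_prop) (by simp)]
  refine integral_congr_ae (.of_forall fun x => ?_)
  dsimp only
  rw [ENNReal.toReal_ofReal (by positivity)]

theorem integrable_exp_neg_mul_sq_norm {ι : Type*} [Fintype ι] {b : ℝ} (hb : 0 < b) :
    Integrable (fun x : EuclideanSpace ℝ ι => Real.exp (-b * ‖x‖ ^ 2)) := by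
  have h := (GaussianFourier.integrable_cexp_neg_mul_sq_norm_add_of_euclideanSpace
    (b := (b : ℂ)) (by simpa using hb) 0 (0 : EuclideanSpace ℝ ι)).norm
  refine h.congr (.of_forall fun x => ?_)
  simp only [Complex.norm_exp]
  norm_cast
  simp

theorem integrable_stdGauss_exp_mul_sq_norm (d : ℕ) {b : ℝ} (hb : b < 1 / 2) :
    Integrable (fun x => Real.exp (b * ‖x‖ ^ 2)) (stdGauss d) := by
  rw [stdGauss, integrable_withDensity_iff (by fun_prop) (by simp)]
  have h := (integrable_exp_neg_mul_sq_norm (ι := Fin d) (b := 1 / 2 - b) (by linarith)).const_mul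
    ((2 * π) ^ (-(d : ℝ) / 2))
  refine h.congr (.of_forall fun x => ?_)
  dsimp only
  rw [ENNReal.toReal_ofReal (by positivity), mul_comm (Real.exp _), mul_assoc, ← Real.exp_add]
  ring_nf

instance (d : ℕ) : IsFiniteMeasure (stdGauss d) := by
  have h := integrable_stdGauss_exp_mul_sq_norm d (b := 0) (by norm_num)
  simp only [zero_mul, Real.exp_zero] at h
  exact (integrable_const_iff_isFiniteMeasure one_ne_zero).1 h

theorem stdGauss_eq_stdGaussian (d : ℕ) :
    stdGauss d = stdGaussian (EuclideanSpace ℝ (Fin d)) := by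
  apply Measure.ext_of_charFun
  ext t
  have h := GaussianFourier.integral_cexp_neg_mul_sq_norm_add_of_euclideanSpace
    (b := (1 / 2 : ℂ)) (by norm_num) Complex.I t
  have h2 : ((2 * π : ℝ) : ℂ) ^ (-((d : ℝ) : ℂ) / 2) * (π / (1 / 2 : ℂ)) ^ ((d : ℂ) / 2) = 1 := by
    have : (π / (1 / 2 : ℂ)) = ((2 * π : ℝ) : ℂ) := by push_cast; ring
    have h0 : ((2 * π : ℝ) : ℂ) ≠ 0 := by
      exact_mod_cast (by positivity : (2 * π : ℝ) ≠ 0)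
    rw [this, ← Complex.cpow_add _ _ h0]
    simp [neg_div]
  rw [charFun_stdGaussian, charFun_apply, integral_stdGauss]
  calc ∫ x, ((2 * π) ^ (-(d : ℝ) / 2) * Real.exp (-‖x‖ ^ 2 / 2)) • Complex.exp (⟪x, t⟫ * Complex.I)
      = ∫ x : EuclideanSpace ℝ (Fin d), ((2 * π : ℝ) : ℂ) ^ (-((d : ℝ) : ℂ) / 2) *
          Complex.exp (-(1 / 2) * ‖x‖ ^ 2 + Complex.I * ⟪t, x⟫) := by
        refine integral_congr_ae (.of_forall fun x => ?_)
        dsimp only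
        rw [Complex.real_smul, Complex.ofReal_mul, Complex.ofReal_cpow (by positivity), mul_assoc,
          Complex.ofReal_exp, ← Complex.exp_add, real_inner_comm]
        push_cast
        ring_nf
    _ = _ := by
        rw [integral_const_mul, h, Fintype.card_fin, ← mul_assoc, h2, one_mul]
        congr 1
        rw [Complex.I_sq]
        ring

instance (d : ℕ) : IsGaussian (stdGauss d) := by
  rw [stdGauss_eq_stdGaussian]; infer_instance

/-- Rotating a pair of independent standard Gaussian vectors preserves its law. -/
theorem measurePreserving_rotation (d : ℕ) (θ : ℝ) :
    MeasurePreserving (ContinuousLinearMap.rotation θ)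
      ((stdGauss d).prod (stdGauss d)) ((stdGauss d).prod (stdGauss d)) := by
  refine ⟨by fun_prop, IsGaussian.map_rotation_eq_self ?_ θ⟩
  rw [stdGauss_eq_stdGaussian]
  exact integral_id_stdGaussian

theorem measurePreserving_neg_stdGauss (d : ℕ) :
    MeasurePreserving (fun x => -x) (stdGauss d) (stdGauss d) := by
  have h := stdGaussian_map (LinearIsometryEquiv.neg ℝ (E := EuclideanSpace ℝ (Fin d)))
  rw [← stdGauss_eq_stdGaussian] at h
  exact ⟨by fun_prop, h⟩

theorem integral_sq_strongDual_stdGauss (d : ℕ) (L : StrongDual ℝ (EuclideanSpace ℝ (Fin d))) :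
    ∫ x, L x ^ 2 ∂stdGauss d = ‖L‖ ^ 2 := by
  have h := variance_dual_stdGaussian L
  rwa [variance_of_integral_eq_zero (by fun_prop) (integral_strongDual_stdGaussian L),
    ← stdGauss_eq_stdGaussian] at h

theorem integral_exp_strongDual_stdGauss (d : ℕ) (L : StrongDual ℝ (EuclideanSpace ℝ (Fin d))) :
    ∫ x, Real.exp (L x) ∂stdGauss d = Real.exp (‖L‖ ^ 2 / 2) := by
  have h := mgf_gaussianReal (IsGaussian.map_eq_gaussianReal (μ := stdGauss d) L) 1
  rw [mgf] at h
  simp only [one_mul] at h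
  rw [h, stdGauss_eq_stdGaussian, variance_dual_stdGaussian, integral_strongDual_stdGaussian]
  simp [Real.coe_toNNReal _ (sq_nonneg ‖L‖)]

/-- The Cameron–Martin formula. -/
theorem integral_stdGauss_add (d : ℕ) (g : EuclideanSpace ℝ (Fin d) → ℝ)
    (v : EuclideanSpace ℝ (Fin d)) :
    ∫ y, g (y + v) ∂stdGauss d =
      ∫ y, Real.exp (⟪v, y⟫ - ‖v‖ ^ 2 / 2) * g y ∂stdGauss d := by
  rw [integral_stdGauss, integral_stdGauss, ← integral_sub_right_eq_self _ v]
  refine integral_congr_ae (.of_forall fun x => ?_)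
  simp only [smul_eq_mul, sub_add_cancel]
  rw [mul_assoc, mul_assoc, ← mul_assoc (Real.exp _) (Real.exp _), ← Real.exp_add,
    norm_sub_sq_real, real_inner_comm]
  ring_nf

theorem integrable_stdGauss_exp_mul_norm (d : ℕ) (b : ℝ) :
    Integrable (fun x => Real.exp (b * ‖x‖)) (stdGauss d) := by
  have h := (integrable_stdGauss_exp_mul_sq_norm d (b := 1 / 4) (by norm_num)).const_mul
    (Real.exp (b ^ 2))
  refine h.mono' (by fun_prop) (.of_forall fun x => ?_)
  rw [Real.norm_eq_abs, Real.abs_exp, ← Real.exp_add]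
  exact Real.exp_le_exp.2 (by nlinarith [sq_nonneg (b - ‖x‖ / 2)])

theorem LipschitzWith.memLp_of_isGaussian {E : Type*} [NormedAddCommGroup E] [NormedSpace ℝ E]
    [MeasurableSpace E] [BorelSpace E] [SecondCountableTopology E] [CompleteSpace E]
    {μ : Measure E} [IsGaussian μ] {K : ℝ≥0} {g : E → ℝ} (hg : LipschitzWith K g)
    {p : ENNReal} (hp : p ≠ ⊤) : MemLp g p μ := by
  have h0 : MemLp (fun x : E => ‖x‖) p μ := (IsGaussian.memLp_id μ p hp).norm
  have h1 : MemLp (fun x : E => |g 0| + K * ‖x‖) p μ :=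
    (memLp_const |g 0|).add (h0.const_mul (K : ℝ))
  refine h1.of_le hg.continuous.aestronglyMeasurable (.of_forall fun x => ?_)
  have h2 := hg.dist_le_mul x 0
  rw [Real.dist_eq, dist_zero_right] at h2
  rw [Real.norm_eq_abs, Real.norm_eq_abs]
  have h3 : |g x| ≤ |g 0| + K * ‖x‖ := by
    have := abs_sub_abs_le_abs_sub (g x) (g 0)
    linarith
  exact h3.trans (le_abs_self _)

theorem integral_comp_rotation {d : ℕ} (θ : ℝ)
    {g : EuclideanSpace ℝ (Fin d) × EuclideanSpace ℝ (Fin d) → ℝ} (hg : Continuous g) :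
    ∫ p, g (ContinuousLinearMap.rotation θ p) ∂(stdGauss d).prod (stdGauss d) =
      ∫ p, g p ∂(stdGauss d).prod (stdGauss d) := by
  have h := measurePreserving_rotation d θ
  conv_rhs => rw [← h.map_eq]
  rw [integral_map h.measurable.aemeasurable hg.aestronglyMeasurable]

/-- The dominating function used for limits of integrals against a pair of Gaussian vectors. -/
theorem integrable_exp_mul_add_norm (d : ℕ) (b : ℝ) :
    Integrable (fun p => Real.exp (b * (‖p.1‖ + ‖p.2‖))) ((stdGauss d).prod (stdGauss d)) := by
  refine ((integrable_stdGauss_exp_mul_norm d b).mul_prod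
    (integrable_stdGauss_exp_mul_norm d b)).congr (.of_forall fun p => ?_)
  dsimp only
  rw [← Real.exp_add]
  ring_nf

theorem ae_differentiableAt_stdGauss {d : ℕ} {K : ℝ≥0} {f : EuclideanSpace ℝ (Fin d) → ℝ}
    (hf : LipschitzWith K f) : ∀ᵐ x ∂stdGauss d, DifferentiableAt ℝ f x :=
  (withDensity_absolutelyContinuous _ _).ae_le (hf.ae_differentiableAt (μ := volume))

/-- Difference quotients of a Lipschitz function along rotations. -/
theorem abs_rotation_slope_le {E : Type*} [NormedAddCommGroup E] [NormedSpace ℝ E] {K : ℝ≥0}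
    {f : E → ℝ} (hf : LipschitzWith K f) {δ : ℝ} (hδ : 0 < δ) (x y : E) :
    |(f (cos δ • x + sin δ • y) - f x) / δ| ≤ K * (‖x‖ + ‖y‖) := by
  have h1 : |cos δ - 1| ≤ δ := by
    rw [abs_sub_comm, abs_of_nonneg (by linarith [cos_le_one δ])]
    rcases le_total δ 2 with h | h
    · nlinarith [one_sub_sq_div_two_le_cos (x := δ)]
    · linarith [neg_one_le_cos δ]
  have h2 : |sin δ| ≤ δ := by
    simpa [abs_of_pos hδ] using abs_sin_le_abs (x := δ)
  have h3 := hf.dist_le_mul (cos δ • x + sin δ • y) x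
  rw [Real.dist_eq, dist_eq_norm] at h3
  have h4 : ‖cos δ • x + sin δ • y - x‖ ≤ δ * (‖x‖ + ‖y‖) := by
    have : cos δ • x + sin δ • y - x = (cos δ - 1) • x + sin δ • y := by module
    rw [this]
    refine (norm_add_le _ _).trans ?_
    rw [norm_smul, norm_smul, Real.norm_eq_abs, Real.norm_eq_abs, mul_add]
    gcongr
  rw [abs_div, abs_of_pos hδ, div_le_iff₀ hδ]
  calc _ ≤ _ := h3
    _ ≤ K * (δ * (‖x‖ + ‖y‖)) := by gcongr
    _ = _ := by ring

theorem tendsto_rotation_slope {E : Type*} [NormedAddCommGroup E] [NormedSpace ℝ E]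
    {f : E → ℝ} {x : E} (hf : DifferentiableAt ℝ f x) (y : E) :
    Tendsto (fun δ : ℝ => (f (cos δ • x + sin δ • y) - f x) / δ) (𝓝[>] 0)
      (𝓝 (fderiv ℝ f x y)) := by
  have hc : HasDerivAt (fun δ : ℝ => cos δ • x + sin δ • y) y 0 := by
    have := ((hasDerivAt_cos 0).smul_const x).fun_add ((hasDerivAt_sin 0).smul_const y)
    simpa using this
  have hx : HasFDerivAt f (fderiv ℝ f x) (cos (0 : ℝ) • x + sin (0 : ℝ) • y) := by
    simpa using hf.hasFDerivAt
  have h := (hx.comp_hasDerivAt (0 : ℝ) hc).tendsto_slope_zero_right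
  refine h.congr fun δ => ?_
  simp [div_eq_inv_mul]

theorem integrable_comp_fderiv_apply {d : ℕ} {K : ℝ≥0} {f : EuclideanSpace ℝ (Fin d) → ℝ}
    (hf : LipschitzWith K f) {F : ℝ → ℝ} (hF : Continuous F) {A B : ℝ} (hA : 0 ≤ A) (hB : 0 ≤ B)
    (hFb : ∀ t, |F t| ≤ A * Real.exp (B * |t|)) :
    Integrable (fun p => F (fderiv ℝ f p.1 p.2)) ((stdGauss d).prod (stdGauss d)) := by
  have hm : Measurable fun p : EuclideanSpace ℝ (Fin d) × EuclideanSpace ℝ (Fin d) =>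
      fderiv ℝ f p.1 p.2 :=
    isBoundedBilinearMap_apply.continuous.measurable.comp
      (((measurable_fderiv ℝ f).comp measurable_fst).prodMk measurable_snd)
  refine ((integrable_exp_mul_add_norm d (B * K)).const_mul A).mono'
    (hF.measurable.comp hm).aestronglyMeasurable (.of_forall fun p => ?_)
  refine (hFb _).trans ?_
  have h1 : |fderiv ℝ f p.1 p.2| ≤ K * (‖p.1‖ + ‖p.2‖) := by
    have := (fderiv ℝ f p.1).le_of_opNorm_le (norm_fderiv_le_of_lipschitz ℝ hf) p.2
    rw [Real.norm_eq_abs] at this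
    exact this.trans (by gcongr; linarith [norm_nonneg p.1])
  rw [mul_assoc B]
  gcongr

theorem tendsto_integral_rotation_slope {d : ℕ} {K : ℝ≥0} {f : EuclideanSpace ℝ (Fin d) → ℝ}
    (hf : LipschitzWith K f) {F : ℝ → ℝ} (hF : Continuous F) {A B : ℝ} (hA : 0 ≤ A) (hB : 0 ≤ B)
    (hFb : ∀ t, |F t| ≤ A * Real.exp (B * |t|)) :
    Tendsto (fun δ : ℝ => ∫ p, F ((f (cos δ • p.1 + sin δ • p.2) - f p.1) / δ)
        ∂(stdGauss d).prod (stdGauss d)) (𝓝[>] 0)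
      (𝓝 (∫ x, ∫ y, F (fderiv ℝ f x y) ∂stdGauss d ∂stdGauss d)) := by
  have hfc := hf.continuous
  rw [← integral_prod (fun p => F (fderiv ℝ f p.1 p.2))
    (integrable_comp_fderiv_apply hf hF hA hB hFb)]
  refine tendsto_integral_filter_of_dominated_convergence _ ?_ ?_
    ((integrable_exp_mul_add_norm d (B * K)).const_mul A) ?_
  · exact .of_forall fun δ => Continuous.aestronglyMeasurable (by fun_prop)
  · filter_upwards [self_mem_nhdsWithin] with δ hδ
    refine .of_forall fun p => (hFb _).trans ?_
    rw [mul_assoc B]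
    have := abs_rotation_slope_le hf hδ p.1 p.2
    gcongr
  · filter_upwards [Measure.quasiMeasurePreserving_fst.ae (ae_differentiableAt_stdGauss hf)]
      with p hp
    exact (hF.tendsto _).comp (tendsto_rotation_slope hp p.2)

/-- The Maurey–Pisier comparison of a difference with its infinitesimal version. -/
theorem integral_exp_sub_le_integral_rotation {d : ℕ} {K : ℝ≥0}
    {f : EuclideanSpace ℝ (Fin d) → ℝ} (hf : LipschitzWith K f) (m : ℕ) :
    ∫ p, Real.exp (f p.2 - f p.1) ∂(stdGauss d).prod (stdGauss d) ≤
      ∫ p, Real.exp (π / 2 * ((f (cos (π / 2 / (m + 1 : ℕ)) • p.1 +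
        sin (π / 2 / (m + 1 : ℕ)) • p.2) - f p.1) / (π / 2 / (m + 1 : ℕ))))
        ∂(stdGauss d).prod (stdGauss d) := by
  set n : ℕ := m + 1 with hn
  have hn0 : (n : ℝ) ≠ 0 := by positivity
  set δ : ℝ := π / 2 / n with hδ
  have hδ0 : 0 < δ := by positivity
  have hfc := hf.continuous
  set g : EuclideanSpace ℝ (Fin d) × EuclideanSpace ℝ (Fin d) → ℝ := fun p =>
    Real.exp (π / 2 * ((f (cos δ • p.1 + sin δ • p.2) - f p.1) / δ)) with hg
  have hgc : Continuous g := by fun_prop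
  have hgi : Integrable g ((stdGauss d).prod (stdGauss d)) := by
    refine (integrable_exp_mul_add_norm d (π / 2 * K)).mono' hgc.aestronglyMeasurable
      (.of_forall fun p => ?_)
    rw [Real.norm_eq_abs, Real.abs_exp, mul_assoc]
    have := (le_abs_self _).trans (abs_rotation_slope_le hf hδ0 p.1 p.2)
    gcongr
  have hinteg : ∀ k : ℕ, Integrable (fun p => g (ContinuousLinearMap.rotation (k * δ) p))
      ((stdGauss d).prod (stdGauss d)) := fun k =>
    (measurePreserving_rotation d (k * δ)).integrable_comp_of_integrable hgi
  have hpt : ∀ p : EuclideanSpace ℝ (Fin d) × EuclideanSpace ℝ (Fin d),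
      Real.exp (f p.2 - f p.1) ≤
        ∑ k ∈ Finset.range n, (n : ℝ)⁻¹ * g (ContinuousLinearMap.rotation (k * δ) p) := by
    intro p
    have hstep : ∀ k : ℕ, g (ContinuousLinearMap.rotation (k * δ) p) =
        Real.exp (n * (f (ContinuousLinearMap.rotation ((k + 1 : ℕ) * δ) p).1 -
          f (ContinuousLinearMap.rotation (k * δ) p).1)) := by
      intro k
      have : cos δ • (ContinuousLinearMap.rotation (k * δ) p).1 +
          sin δ • (ContinuousLinearMap.rotation (k * δ) p).2 =
          (ContinuousLinearMap.rotation ((k + 1 : ℕ) * δ) p).1 := by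
        simp only [ContinuousLinearMap.rotation_apply]
        push_cast
        rw [add_mul, one_mul, cos_add, sin_add]
        module
      simp only [hg]
      rw [this]
      congr 1
      rw [hδ]
      field_simp
    have hsum : f p.2 - f p.1 = ∑ k ∈ Finset.range n, (n : ℝ)⁻¹ •
        (n * (f (ContinuousLinearMap.rotation ((k + 1 : ℕ) * δ) p).1 -
          f (ContinuousLinearMap.rotation (k * δ) p).1)) := by
      have : (n : ℝ) * δ = π / 2 := by rw [hδ]; field_simp
      simp only [smul_eq_mul, inv_mul_cancel_left₀ hn0]
      rw [Finset.sum_range_sub (fun k : ℕ => f (ContinuousLinearMap.rotation (k * δ) p).1)]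
      simp [ContinuousLinearMap.rotation_apply, this]
    rw [hsum]
    simp only [hstep]
    refine convexOn_exp.map_sum_le (fun _ _ => by positivity) ?_ (fun _ _ => Set.mem_univ _)
    simp [hn0]
  calc _ ≤ ∫ p, ∑ k ∈ Finset.range n, (n : ℝ)⁻¹ * g (ContinuousLinearMap.rotation (k * δ) p)
        ∂(stdGauss d).prod (stdGauss d) :=
        integral_mono_of_nonneg (.of_forall fun p => (Real.exp_pos _).le)
          (integrable_finsetSum _ fun k _ => (hinteg k).const_mul _) (.of_forall hpt)
    _ = ∑ k ∈ Finset.range n, (n : ℝ)⁻¹ * ∫ p, g p ∂(stdGauss d).prod (stdGauss d) := by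
        rw [integral_finsetSum _ fun k _ => (hinteg k).const_mul _]
        refine Finset.sum_congr rfl fun k _ => ?_
        rw [integral_const_mul, integral_comp_rotation _ hgc]
    _ = _ := by simp [hn0]

/-- Gaussian concentration for the difference of two independent copies. -/
theorem integral_exp_sub_le {d : ℕ} {K : ℝ≥0} {f : EuclideanSpace ℝ (Fin d) → ℝ}
    (hf : LipschitzWith K f) :
    ∫ p, Real.exp (f p.2 - f p.1) ∂(stdGauss d).prod (stdGauss d) ≤
      Real.exp (π ^ 2 / 8 * K ^ 2) := by
  have hlim := tendsto_integral_rotation_slope hf (F := fun t => Real.exp (π / 2 * t))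
    (by fun_prop) zero_le_one (B := π / 2) (by positivity) (fun t => by
      rw [Real.abs_exp, one_mul]
      gcongr
      exact le_abs_self t)
  have hδ : Tendsto (fun m : ℕ => π / 2 / ((m + 1 : ℕ) : ℝ)) atTop (𝓝[>] 0) := by
    refine tendsto_nhdsWithin_iff.2 ⟨?_, .of_forall fun m => ?_⟩
    · exact ((tendsto_natCast_atTop_atTop (R := ℝ)).comp (tendsto_add_atTop_nat 1)).const_div_atTop _
    · exact Set.mem_Ioi.2 (by positivity)
  refine (ge_of_tendsto' (hlim.comp hδ) fun m =>
    integral_exp_sub_le_integral_rotation hf m).trans ?_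
  have hval : ∀ x, ∫ y, Real.exp (π / 2 * fderiv ℝ f x y) ∂stdGauss d ≤
      Real.exp (π ^ 2 / 8 * K ^ 2) := by
    intro x
    have h := integral_exp_strongDual_stdGauss d ((π / 2) • fderiv ℝ f x)
    simp only [_root_.smul_apply, smul_eq_mul] at h
    rw [h, norm_smul, Real.norm_of_nonneg (by positivity)]
    have := norm_fderiv_le_of_lipschitz ℝ hf (x₀ := x)
    calc Real.exp ((π / 2 * ‖fderiv ℝ f x‖) ^ 2 / 2) ≤ Real.exp ((π / 2 * K) ^ 2 / 2) := by gcongr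
      _ = _ := by ring_nf
  refine (integral_mono_of_nonneg (.of_forall fun x => integral_nonneg fun y => (Real.exp_pos _).le)
    (integrable_const _) (.of_forall hval)).trans ?_
  simp

theorem integrable_exp_of_lipschitz {d : ℕ} {K : ℝ≥0} {f : EuclideanSpace ℝ (Fin d) → ℝ}
    (hf : LipschitzWith K f) : Integrable (fun x => Real.exp (f x)) (stdGauss d) := by
  have hfc := hf.continuous
  refine ((integrable_stdGauss_exp_mul_norm d K).const_mul (Real.exp (f 0))).mono'
    (by fun_prop) (.of_forall fun x => ?_)
  have h := (le_abs_self _).trans (hf.dist_le_mul x 0)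
  rw [dist_zero_right] at h
  rw [Real.norm_eq_abs, Real.abs_exp, ← Real.exp_add]
  exact Real.exp_le_exp.2 (by linarith)

/-- Gaussian concentration: the Laplace transform of a centred Lipschitz function. -/
theorem integral_exp_le_of_integral_eq_zero {d : ℕ} {K : ℝ≥0}
    {f : EuclideanSpace ℝ (Fin d) → ℝ} (hf : LipschitzWith K f) (h0 : ∫ x, f x ∂stdGauss d = 0) :
    ∫ x, Real.exp (f x) ∂stdGauss d ≤ Real.exp (π ^ 2 / 8 * K ^ 2) := by
  have hfi : Integrable f (stdGauss d) :=
    memLp_one_iff_integrable.1 (hf.memLp_of_isGaussian ENNReal.one_ne_top)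
  have hneg : LipschitzWith K fun x => -f x := hf.neg
  have hJ : 1 ≤ ∫ x, Real.exp (-f x) ∂stdGauss d := by
    have h1 : ∫ x, (-f x + 1) ∂stdGauss d ≤ ∫ x, Real.exp (-f x) ∂stdGauss d :=
      integral_mono (hfi.neg.add (integrable_const 1)) (integrable_exp_of_lipschitz hneg)
        fun x => add_one_le_exp _
    rw [integral_add (f := fun x => -f x) hfi.neg (integrable_const 1)] at h1
    simpa [integral_neg, h0] using h1
  have hprod : ∫ p, Real.exp (f p.2 - f p.1) ∂(stdGauss d).prod (stdGauss d) =
      (∫ x, Real.exp (-f x) ∂stdGauss d) * ∫ x, Real.exp (f x) ∂stdGauss d := by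
    rw [← integral_prod_mul]
    refine integral_congr_ae (.of_forall fun p => ?_)
    dsimp only
    rw [← Real.exp_add, neg_add_eq_sub]
  have h := integral_exp_sub_le hf
  rw [hprod] at h
  have : 0 ≤ ∫ x, Real.exp (f x) ∂stdGauss d := integral_nonneg fun x => (Real.exp_pos _).le
  nlinarith

/-- The average of `f` over a Gaussian perturbation of size `b` around `a • x`. For
`a ^ 2 + b ^ 2 = 1` this is the Ornstein–Uhlenbeck semigroup. -/
noncomputable def ouMean {d : ℕ} (f : EuclideanSpace ℝ (Fin d) → ℝ) (a b : ℝ)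
    (x : EuclideanSpace ℝ (Fin d)) : ℝ :=
  ∫ y, f (a • x + b • y) ∂stdGauss d

theorem Real.abs_exp_sub_one_sub_id_le_sq_mul_exp (t : ℝ) :
    |Real.exp t - 1 - t| ≤ t ^ 2 * Real.exp |t| := by
  have h := Complex.norm_exp_sub_sum_le_norm_mul_exp (t : ℂ) 2
  simp only [Finset.sum_range_succ, Finset.sum_range_zero] at h
  norm_num at h
  norm_cast at h
  rwa [Real.norm_eq_abs, ← sub_sub] at h

section

variable {d : ℕ} {K : ℝ≥0} {f : EuclideanSpace ℝ (Fin d) → ℝ}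

theorem LipschitzWith.comp_smul_add_smul (hf : LipschitzWith K f) (a b : ℝ) :
    ∃ K' : ℝ≥0, LipschitzWith K'
      fun p : EuclideanSpace ℝ (Fin d) × EuclideanSpace ℝ (Fin d) => f (a • p.1 + b • p.2) :=
  ⟨_, hf.comp (a • ContinuousLinearMap.fst ℝ (EuclideanSpace ℝ (Fin d)) (EuclideanSpace ℝ (Fin d)) +
    b • ContinuousLinearMap.snd ℝ (EuclideanSpace ℝ (Fin d))
      (EuclideanSpace ℝ (Fin d))).lipschitz⟩

theorem memLp_comp_smul_add_smul (hf : LipschitzWith K f) (a b : ℝ) {p : ENNReal} (hp : p ≠ ⊤) :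
    MemLp (fun q : EuclideanSpace ℝ (Fin d) × EuclideanSpace ℝ (Fin d) => f (a • q.1 + b • q.2)) p
      ((stdGauss d).prod (stdGauss d)) := by
  obtain ⟨K', hK'⟩ := hf.comp_smul_add_smul a b
  exact hK'.memLp_of_isGaussian hp

theorem LipschitzWith.add_smul (hf : LipschitzWith K f) (w : EuclideanSpace ℝ (Fin d)) (b : ℝ) :
    LipschitzWith (K * ‖b‖₊) fun y => f (w + b • y) := by
  have h : LipschitzWith ‖b‖₊ fun y : EuclideanSpace ℝ (Fin d) => w + b • y := by
    simpa using (LipschitzWith.const w).add (lipschitzWith_smul (β := EuclideanSpace ℝ (Fin d)) b)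
  exact hf.comp h

theorem integrable_comp_add_smul (hf : LipschitzWith K f) (w : EuclideanSpace ℝ (Fin d)) (b : ℝ) :
    Integrable (fun y => f (w + b • y)) (stdGauss d) :=
  memLp_one_iff_integrable.1 ((hf.add_smul w b).memLp_of_isGaussian ENNReal.one_ne_top)

theorem LipschitzWith.ouMean (hf : LipschitzWith K f) (a b : ℝ) :
    LipschitzWith (K * ‖a‖₊) (ouMean f a b) := by
  refine LipschitzWith.of_dist_le_mul fun x x' => ?_
  rw [Real.dist_eq, _root_.ouMean, _root_.ouMean,
    ← integral_sub (integrable_comp_add_smul hf _ _) (integrable_comp_add_smul hf _ _)]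
  have hle : ∀ y, ‖f (a • x + b • y) - f (a • x' + b • y)‖ ≤ (K * ‖a‖₊ : ℝ≥0) * dist x x' := by
    intro y
    refine (hf.dist_le_mul _ _).trans ?_
    rw [dist_add_right, dist_smul₀, NNReal.coe_mul, mul_assoc]
    simp
  simpa using norm_integral_le_of_norm_le_const (μ := stdGauss d) (.of_forall hle)

theorem integral_mul_ouMean (hf : LipschitzWith K f) {K' : ℝ≥0}
    {g : EuclideanSpace ℝ (Fin d) → ℝ} (hg : LipschitzWith K' g) (a b : ℝ) :
    ∫ x, g x * ouMean f a b x ∂stdGauss d =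
      ∫ p, g p.1 * f (a • p.1 + b • p.2) ∂(stdGauss d).prod (stdGauss d) := by
  rw [integral_prod]
  · simp only [ouMean, integral_const_mul]
  · have h := memLp_comp_smul_add_smul hg 1 0 (p := 2) (by simp)
    simp only [one_smul, zero_smul, add_zero] at h
    exact h.integrable_mul (memLp_comp_smul_add_smul hf a b (p := 2) (by simp))

/-- A sum of two independent Gaussian perturbations is a Gaussian perturbation. -/
theorem integral_integral_add_smul (hf : LipschitzWith K f) (w : EuclideanSpace ℝ (Fin d))
    {s t σ : ℝ} (hσ : 0 ≤ σ) (h : σ ^ 2 = s ^ 2 + t ^ 2) :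
    ∫ v, ∫ y, f (w + (s • v + t • y)) ∂stdGauss d ∂stdGauss d =
      ∫ z, f (w + σ • z) ∂stdGauss d := by
  have hfc := hf.continuous
  have hσ' : ‖(⟨s, t⟩ : ℂ)‖ = σ := by
    rw [Complex.norm_def, Complex.normSq_mk, ← sq, ← sq, ← h, Real.sqrt_sq hσ]
  have hs := Complex.norm_mul_cos_arg (⟨s, t⟩ : ℂ)
  have ht := Complex.norm_mul_sin_arg (⟨s, t⟩ : ℂ)
  rw [hσ'] at hs ht
  dsimp only at hs ht
  have h1 := memLp_comp_smul_add_smul (f := fun x => f (w + (1 : ℝ) • x)) (hf.add_smul w 1)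
    s t (p := 1) (by simp)
  simp only [one_smul] at h1
  rw [← integral_prod (fun p : EuclideanSpace ℝ (Fin d) × EuclideanSpace ℝ (Fin d) =>
    f (w + (s • p.1 + t • p.2))) (memLp_one_iff_integrable.1 h1)]
  have h2 := integral_comp_rotation (d := d) (Complex.arg ⟨s, t⟩)
    (g := fun p => f (w + σ • p.1)) (by fun_prop)
  rw [integral_fun_fst (fun x => f (w + σ • x))] at h2
  simp only [probReal_univ, one_smul] at h2
  rw [← h2]
  refine integral_congr_ae (.of_forall fun p => ?_)
  simp only [ContinuousLinearMap.rotation_apply, smul_add, smul_smul, hs, ht]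

theorem integral_ouMean_sq (hf : LipschitzWith K f) {c : ℝ} (hc : c ∈ Set.Icc (0 : ℝ) 1) :
    ∫ x, ouMean f c √(1 - c ^ 2) x ^ 2 ∂stdGauss d =
      ∫ x, f x * ouMean f (c ^ 2) √(1 - (c ^ 2) ^ 2) x ∂stdGauss d := by
  set s := √(1 - c ^ 2) with hs
  have hs2 : s ^ 2 = 1 - c ^ 2 := Real.sq_sqrt (by nlinarith [hc.1, hc.2])
  set G := ouMean f c s with hGdef
  have hG : LipschitzWith (K * ‖c‖₊) G := hf.ouMean c s
  have hfc := hf.continuous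
  have hGc := hG.continuous
  have hcos : cos (arccos c) = c := cos_arccos (by linarith [hc.1]) hc.2
  have hsin : sin (arccos c) = s := sin_arccos c
  have hrot := integral_comp_rotation (d := d) (arccos c)
    (g := fun p => f p.1 * G (c • p.1 + (-s) • p.2)) (by fun_prop)
  have h3 : c ^ 2 + s * s = 1 := by nlinarith
  have hpt : ∀ p : EuclideanSpace ℝ (Fin d) × EuclideanSpace ℝ (Fin d),
      c • (c • p.1 + s • p.2) + (-s) • (-s • p.1 + c • p.2) = p.1 := by
    intro p
    calc _ = (c ^ 2 + s * s) • p.1 := by module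
      _ = p.1 := by rw [h3, one_smul]
  simp only [ContinuousLinearMap.rotation_apply, hcos, hsin, hpt] at hrot
  calc ∫ x, G x ^ 2 ∂stdGauss d = ∫ x, G x * ouMean f c s x ∂stdGauss d := by
        simp only [← hGdef, sq]
    _ = ∫ p, G p.1 * f (c • p.1 + s • p.2) ∂(stdGauss d).prod (stdGauss d) :=
        integral_mul_ouMean hf hG c s
    _ = ∫ p, f p.1 * G (c • p.1 + (-s) • p.2) ∂(stdGauss d).prod (stdGauss d) := by
        rw [← hrot]
        simp only [mul_comm]
    _ = ∫ x, f x * ouMean G c (-s) x ∂stdGauss d := (integral_mul_ouMean hG hf c (-s)).symm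
    _ = _ := by
        refine integral_congr_ae (.of_forall fun x => ?_)
        dsimp only
        congr 1
        simp only [ouMean, hGdef]
        rw [← integral_integral_add_smul hf ((c ^ 2) • x) (s := c * -s) (t := s)
          (Real.sqrt_nonneg _) (by
            rw [Real.sq_sqrt (by nlinarith [pow_le_one₀ hc.1 hc.2 (n := 4)])]
            nlinarith)]
        refine integral_congr_ae (.of_forall fun v => integral_congr_ae (.of_forall fun y => ?_))
        dsimp only
        congr 1
        module

theorem sq_integral_mul_ouMean_le (hf : LipschitzWith K f) {c : ℝ} (hc : c ∈ Set.Icc (0 : ℝ) 1) :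
    (∫ x, f x * ouMean f c √(1 - c ^ 2) x ∂stdGauss d) ^ 2 ≤
      (∫ x, f x ^ 2 ∂stdGauss d) *
        ∫ x, f x * ouMean f (c ^ 2) √(1 - (c ^ 2) ^ 2) x ∂stdGauss d := by
  rw [← integral_ouMean_sq hf hc]
  set G := ouMean f c √(1 - c ^ 2)
  have hG : LipschitzWith (K * ‖c‖₊) G := hf.ouMean c _
  have hf2 : MemLp f 2 (stdGauss d) := hf.memLp_of_isGaussian (by simp)
  have hG2 : MemLp G 2 (stdGauss d) := hG.memLp_of_isGaussian (by simp)
  have hfG : Integrable (fun x => f x * G x) (stdGauss d) := hf2.integrable_mul hG2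
  have key : ∀ t : ℝ, 0 ≤ (∫ x, f x ^ 2 ∂stdGauss d) * (t * t) +
      (2 * ∫ x, f x * G x ∂stdGauss d) * t + ∫ x, G x ^ 2 ∂stdGauss d := by
    intro t
    have h : ∫ x, (t * f x + G x) ^ 2 ∂stdGauss d = (∫ x, f x ^ 2 ∂stdGauss d) * (t * t) +
        (2 * ∫ x, f x * G x ∂stdGauss d) * t + ∫ x, G x ^ 2 ∂stdGauss d := by
      rw [← integral_const_mul, ← integral_mul_const, ← integral_mul_const,
        ← integral_add (hf2.integrable_sq.mul_const _) ((hfG.const_mul _).mul_const _),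
        ← integral_add _ hG2.integrable_sq]
      · refine integral_congr_ae (.of_forall fun x => ?_)
        dsimp only
        ring
      · exact (hf2.integrable_sq.mul_const _).add ((hfG.const_mul _).mul_const _)
    rw [← h]
    exact integral_nonneg fun x => sq_nonneg _
  have hd := discrim_le_zero key
  rw [discrim] at hd
  nlinarith

end

theorem abs_exp_sub_sub_one_sub_le {t q B : ℝ} (hq : 0 ≤ q) (hqB : q ≤ B) (c : ℝ)
    (ht : t ^ 2 ≤ B * c) :
    |Real.exp (t - q) - 1 - t| ≤ B * (1 + c) * Real.exp |t| := by
  have h1 := Real.abs_exp_sub_one_sub_id_le_sq_mul_exp t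
  have h2 : Real.exp (-q) ≤ 1 := Real.exp_le_one_iff.2 (by linarith)
  have h3 : 1 - q ≤ Real.exp (-q) := by linarith [add_one_le_exp (-q)]
  have h4 : |1 + t| ≤ Real.exp |t| := by
    refine (abs_add_le 1 t).trans ?_
    rw [abs_one]
    linarith [add_one_le_exp |t|]
  have h5 : Real.exp (t - q) - 1 - t =
      Real.exp (-q) * (Real.exp t - 1 - t) + (Real.exp (-q) - 1) * (1 + t) := by
    rw [sub_eq_add_neg t q, Real.exp_add]
    ring
  have h6 : |Real.exp (-q) - 1| ≤ q := by
    rw [abs_sub_comm, abs_of_nonneg (by linarith)]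
    linarith
  rw [h5]
  calc _ ≤ |Real.exp (-q) * (Real.exp t - 1 - t)| + |(Real.exp (-q) - 1) * (1 + t)| :=
        abs_add_le _ _
    _ ≤ 1 * (t ^ 2 * Real.exp |t|) + q * Real.exp |t| := by
        rw [abs_mul, abs_mul, Real.abs_exp]
        gcongr
    _ ≤ 1 * (B * c * Real.exp |t|) + B * Real.exp |t| := by gcongr
    _ = _ := by ring

theorem mul_one_add_sq_mul_exp_le {M u : ℝ} (hM : 0 ≤ M) (hu : 0 ≤ u) :
    M * (1 + u) * ((1 + u) * Real.exp (u / 8)) ≤ 256 * M * Real.exp (1 / 4 * u) := by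
  have h1 : 1 + u ≤ 16 * Real.exp (u / 16) := by linarith [add_one_le_exp (u / 16)]
  have h2 : (1 + u) ^ 2 ≤ 256 * Real.exp (u / 8) := by
    calc (1 + u) ^ 2 ≤ (16 * Real.exp (u / 16)) ^ 2 := by gcongr
      _ = 256 * (Real.exp (u / 16) * Real.exp (u / 16)) := by ring
      _ = 256 * Real.exp (u / 8) := by rw [← Real.exp_add]; ring_nf
  calc M * (1 + u) * ((1 + u) * Real.exp (u / 8)) = M * (1 + u) ^ 2 * Real.exp (u / 8) := by ring
    _ ≤ M * (256 * Real.exp (u / 8)) * Real.exp (u / 8) := by gcongr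
    _ = 256 * M * (Real.exp (u / 8) * Real.exp (u / 8)) := by ring
    _ = _ := by rw [← Real.exp_add]; ring_nf

section

variable {d : ℕ} {K : ℝ≥0} {f : EuclideanSpace ℝ (Fin d) → ℝ}

theorem LipschitzWith.abs_le_mul_one_add_sq (hf : LipschitzWith K f)
    {x y : EuclideanSpace ℝ (Fin d)} (hxy : ‖x‖ ≤ ‖y‖) :
    |f x| ≤ (|f 0| + K) * (1 + ‖y‖ ^ 2) := by
  have h1 := hf.dist_le_mul x 0
  rw [Real.dist_eq, dist_zero_right] at h1
  have h2 := abs_sub_abs_le_abs_sub (f x) (f 0)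
  have h3 : ‖x‖ ≤ 1 + ‖y‖ ^ 2 := by nlinarith [sq_nonneg (‖y‖ - 1 / 2)]
  have h4 : (K : ℝ) * ‖x‖ ≤ K * (1 + ‖y‖ ^ 2) := by gcongr
  nlinarith [abs_nonneg (f 0), sq_nonneg ‖y‖, mul_nonneg (abs_nonneg (f 0)) (sq_nonneg ‖y‖)]

/-- For even `f`, the first order term in the small correlation expansion vanishes. -/
theorem abs_ouMean_sub_le (hf : LipschitzWith K f) (heven : ∀ x, f (-x) = f x) {r : ℝ}
    (hr : r ∈ Set.Icc (0 : ℝ) (1 / 5)) (x : EuclideanSpace ℝ (Fin d)) :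
    |ouMean f r √(1 - r ^ 2) x - ∫ y, f (√(1 - r ^ 2) • y) ∂stdGauss d| ≤
      4 * r ^ 2 * (256 * (|f 0| + K) * ∫ y, Real.exp (1 / 4 * ‖y‖ ^ 2) ∂stdGauss d) *
        (‖x‖ ^ 2 * Real.exp (‖x‖ ^ 2 / 8)) := by
  obtain ⟨hr0, hr1⟩ := hr
  have hfc := hf.continuous
  set s := √(1 - r ^ 2) with hs
  have hs2 : s ^ 2 = 1 - r ^ 2 := Real.sq_sqrt (by nlinarith)
  have hs0 : 0 ≤ s := Real.sqrt_nonneg _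
  have hs1 : s ≤ 1 := by nlinarith
  have hs3 : 9 / 10 ≤ s := by nlinarith
  have hspos : 0 < s := by linarith
  set a := r / s with ha
  have ha0 : 0 ≤ a := by positivity
  have ha1 : a ≤ 2 * r := by rw [ha, div_le_iff₀ hspos]; nlinarith
  have ha2 : a ≤ 1 / 4 := by rw [ha, div_le_iff₀ hspos]; nlinarith
  have hsa : s * a = r := by rw [ha]; field_simp
  set M := |f 0| + K
  have hM : 0 ≤ M := by positivity
  have hcm : ouMean f r s x =
      ∫ y, Real.exp (⟪a • x, y⟫ - ‖a • x‖ ^ 2 / 2) * f (s • y) ∂stdGauss d := by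
    rw [← integral_stdGauss_add d (fun y => f (s • y)), ouMean]
    refine integral_congr_ae (.of_forall fun y => ?_)
    dsimp only
    rw [smul_add, smul_smul, hsa, add_comm]
  have hbound : ∀ y, ‖(Real.exp (⟪a • x, y⟫ - ‖a • x‖ ^ 2 / 2) - 1 - ⟪a • x, y⟫) * f (s • y)‖ ≤
      4 * r ^ 2 * (‖x‖ ^ 2 * Real.exp (‖x‖ ^ 2 / 8)) *
        (256 * M * Real.exp (1 / 4 * ‖y‖ ^ 2)) := by
    intro y
    have hin : |⟪a • x, y⟫| ≤ a * ‖x‖ * ‖y‖ := by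
      refine (abs_real_inner_le_norm _ _).trans ?_
      rw [norm_smul, Real.norm_of_nonneg ha0]
    have hin2 : ⟪a • x, y⟫ ^ 2 ≤ a ^ 2 * ‖x‖ ^ 2 * ‖y‖ ^ 2 := by
      rw [← sq_abs]
      calc |⟪a • x, y⟫| ^ 2 ≤ (a * ‖x‖ * ‖y‖) ^ 2 := by gcongr
        _ = _ := by ring
    have hnorm : ‖a • x‖ ^ 2 = a ^ 2 * ‖x‖ ^ 2 := by
      rw [norm_smul, Real.norm_of_nonneg ha0]; ring
    have hin3 : |⟪a • x, y⟫| ≤ ‖x‖ ^ 2 / 8 + ‖y‖ ^ 2 / 8 := by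
      have : a * (‖x‖ * ‖y‖) ≤ 1 / 4 * (‖x‖ * ‖y‖) := by gcongr
      nlinarith [sq_nonneg (‖x‖ - ‖y‖)]
    have h1 := abs_exp_sub_sub_one_sub_le (t := ⟪a • x, y⟫) (q := ‖a • x‖ ^ 2 / 2)
      (B := a ^ 2 * ‖x‖ ^ 2) (by positivity) (by rw [hnorm]; nlinarith [sq_nonneg (a * ‖x‖)])
      (‖y‖ ^ 2) hin2
    have hfy : |f (s • y)| ≤ M * (1 + ‖y‖ ^ 2) := hf.abs_le_mul_one_add_sq (by
      rw [norm_smul, Real.norm_of_nonneg hs0]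
      nlinarith [norm_nonneg y])
    have ha3 : a ^ 2 ≤ 4 * r ^ 2 := by nlinarith
    rw [norm_mul, Real.norm_eq_abs, Real.norm_eq_abs]
    calc _ ≤ a ^ 2 * ‖x‖ ^ 2 * (1 + ‖y‖ ^ 2) * Real.exp |⟪a • x, y⟫| * (M * (1 + ‖y‖ ^ 2)) := by
          gcongr
      _ ≤ 4 * r ^ 2 * ‖x‖ ^ 2 * (1 + ‖y‖ ^ 2) * Real.exp (‖x‖ ^ 2 / 8 + ‖y‖ ^ 2 / 8) *
          (M * (1 + ‖y‖ ^ 2)) := by gcongr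
      _ = 4 * r ^ 2 * (‖x‖ ^ 2 * Real.exp (‖x‖ ^ 2 / 8)) *
          (M * (1 + ‖y‖ ^ 2) * ((1 + ‖y‖ ^ 2) * Real.exp (‖y‖ ^ 2 / 8))) := by
          rw [Real.exp_add]; ring
      _ ≤ _ := by
          have := mul_one_add_sq_mul_exp_le hM (sq_nonneg ‖y‖)
          gcongr
  have hinteg := (integrable_stdGauss_exp_mul_sq_norm d (b := 1 / 4) (by norm_num)).const_mul (256 * M)
  have hi0 : Integrable (fun y => f (s • y)) (stdGauss d) := by
    simpa using integrable_comp_add_smul hf 0 s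
  have hf2 : MemLp (fun y => f (s • y)) 2 (stdGauss d) := by
    have := (hf.add_smul 0 s).memLp_of_isGaussian (μ := stdGauss d) (p := 2) (by simp)
    simpa using this
  have hL2 : MemLp (fun y => ⟪a • x, y⟫) 2 (stdGauss d) :=
    (innerSL ℝ (a • x)).lipschitz.memLp_of_isGaussian (by simp)
  have hi1 : Integrable (fun y => ⟪a • x, y⟫ * f (s • y)) (stdGauss d) := hL2.integrable_mul hf2
  have hi2 : Integrable (fun y => (Real.exp (⟪a • x, y⟫ - ‖a • x‖ ^ 2 / 2) - 1 - ⟪a • x, y⟫) *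
      f (s • y)) (stdGauss d) :=
    (hinteg.const_mul _).mono' (by fun_prop) (.of_forall hbound)
  have hi01 : Integrable (fun y => f (s • y) + ⟪a • x, y⟫ * f (s • y)) (stdGauss d) := hi0.add hi1
  have hodd : ∫ y, ⟪a • x, y⟫ * f (s • y) ∂stdGauss d = 0 := by
    have h := integral_map (μ := stdGauss d) (φ := fun y => -y) (by fun_prop)
      (f := fun y => ⟪a • x, y⟫ * f (s • y)) (by fun_prop)
    rw [(measurePreserving_neg_stdGauss d).map_eq] at h
    simp only [inner_neg_right, smul_neg, heven, neg_mul, integral_neg] at h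
    linarith
  have hdiff : ouMean f r s x - ∫ y, f (s • y) ∂stdGauss d =
      ∫ y, (Real.exp (⟪a • x, y⟫ - ‖a • x‖ ^ 2 / 2) - 1 - ⟪a • x, y⟫) * f (s • y) ∂stdGauss d := by
    rw [hcm, sub_eq_iff_eq_add, ← add_zero (∫ y, f (s • y) ∂stdGauss d), ← hodd,
      ← integral_add hi0 hi1, ← integral_add hi2 hi01]
    refine integral_congr_ae (.of_forall fun y => ?_)
    dsimp only
    ring
  rw [hdiff, ← integral_const_mul]
  calc _ ≤ ∫ y, 4 * r ^ 2 * (‖x‖ ^ 2 * Real.exp (‖x‖ ^ 2 / 8)) *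
        (256 * M * Real.exp (1 / 4 * ‖y‖ ^ 2)) ∂stdGauss d :=
        norm_integral_le_of_norm_le (hinteg.const_mul _) (.of_forall hbound)
    _ = _ := by rw [integral_const_mul]; ring

theorem exists_integral_mul_ouMean_le (hf : LipschitzWith K f) (heven : ∀ x, f (-x) = f x)
    (h0 : ∫ x, f x ∂stdGauss d = 0) :
    ∃ N : ℝ, ∀ r ∈ Set.Icc (0 : ℝ) (1 / 5),
      ∫ x, f x * ouMean f r √(1 - r ^ 2) x ∂stdGauss d ≤ N * r ^ 2 := by
  set I := ∫ y, Real.exp (1 / 4 * ‖y‖ ^ 2) ∂stdGauss d with hI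
  set M := |f 0| + K
  have hM : 0 ≤ M := by positivity
  have hI0 : 0 ≤ I := integral_nonneg fun y => (Real.exp_pos _).le
  refine ⟨4 * (256 * M * I) * (256 * M * I), fun r hr => ?_⟩
  set s := √(1 - r ^ 2)
  set G₀ := ∫ y, f (s • y) ∂stdGauss d
  have hG : LipschitzWith (K * ‖r‖₊) (ouMean f r s) := hf.ouMean r s
  have hf2 : MemLp f 2 (stdGauss d) := hf.memLp_of_isGaussian (by simp)
  have hG2 : MemLp (ouMean f r s) 2 (stdGauss d) := hG.memLp_of_isGaussian (by simp)
  have hfG : Integrable (fun x => f x * ouMean f r s x) (stdGauss d) := hf2.integrable_mul hG2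
  have hfi : Integrable f (stdGauss d) := hf2.integrable (by norm_num)
  have hinteg := (integrable_stdGauss_exp_mul_sq_norm d (b := 1 / 4) (by norm_num)).const_mul (256 * M)
  have hshift : ∫ x, f x * ouMean f r s x ∂stdGauss d =
      ∫ x, (f x * ouMean f r s x - f x * G₀) ∂stdGauss d := by
    rw [integral_sub hfG (hfi.mul_const _), integral_mul_const, h0]
    ring
  rw [hshift]
  calc _ ≤ ∫ x, 4 * r ^ 2 * (256 * M * I) * (256 * M * Real.exp (1 / 4 * ‖x‖ ^ 2)) ∂stdGauss d := by
        refine integral_mono (hfG.sub (hfi.mul_const _)) (hinteg.const_mul _) fun x => ?_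
        dsimp only
        have h1 := abs_ouMean_sub_le hf heven hr x
        have h2 : |f x| ≤ M * (1 + ‖x‖ ^ 2) := hf.abs_le_mul_one_add_sq le_rfl
        rw [← mul_sub]
        refine (le_abs_self _).trans ?_
        rw [abs_mul]
        calc _ ≤ M * (1 + ‖x‖ ^ 2) * (4 * r ^ 2 * (256 * M * I) *
              ((1 + ‖x‖ ^ 2) * Real.exp (‖x‖ ^ 2 / 8))) := by
              gcongr
              refine h1.trans ?_
              gcongr
              linarith
          _ = 4 * r ^ 2 * (256 * M * I) *
              (M * (1 + ‖x‖ ^ 2) * ((1 + ‖x‖ ^ 2) * Real.exp (‖x‖ ^ 2 / 8))) := by ring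
          _ ≤ _ := by
              have := mul_one_add_sq_mul_exp_le hM (sq_nonneg ‖x‖)
              gcongr
    _ = _ := by
        rw [integral_const_mul, integral_const_mul]
        ring

end

/-- A quadratic bound near zero propagates to `(0, 1)` with the optimal constant. -/
theorem le_sq_mul_of_sq_le_mul_comp_sq {T : ℝ → ℝ} {V N : ℝ} (hV : 0 ≤ V)
    (hT : ∀ c ∈ Set.Icc (0 : ℝ) 1, T c ^ 2 ≤ V * T (c ^ 2))
    (hN : ∀ r ∈ Set.Icc (0 : ℝ) (1 / 5), T r ≤ N * r ^ 2) {ρ : ℝ} (hρ : ρ ∈ Set.Ioo (0 : ℝ) 1) :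
    T ρ ≤ ρ ^ 2 * V := by
  obtain ⟨hρ0, hρ1⟩ := hρ
  by_contra! hcon
  have hVpos : 0 < V := by
    rcases hV.eq_or_lt with h | h
    · have := hT ρ ⟨hρ0.le, hρ1.le⟩
      rw [← h] at this hcon
      nlinarith
    · exact h
  set l := T ρ / (ρ ^ 2 * V) with hl
  have hl1 : 1 < l := by rw [hl, one_lt_div (by positivity)]; exact hcon
  have hgrow : ∀ k : ℕ, V * (l * ρ ^ 2) ^ (2 ^ k) ≤ T (ρ ^ (2 ^ k)) := by
    intro k
    induction k with
    | zero => simp only [pow_zero, pow_one]; rw [hl]; exact le_of_eq (by field_simp)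
    | succ k ih =>
      have h1 := hT (ρ ^ (2 ^ k)) ⟨by positivity, pow_le_one₀ hρ0.le hρ1.le⟩
      rw [← pow_mul, ← pow_succ] at h1
      have h2 : (V * (l * ρ ^ 2) ^ (2 ^ k)) ^ 2 ≤ T (ρ ^ (2 ^ k)) ^ 2 := by gcongr
      rw [mul_pow, ← pow_mul, ← pow_succ, sq V, mul_assoc] at h2
      exact le_of_mul_le_mul_left (h2.trans h1) hVpos
  have h2k : Tendsto (fun k : ℕ => 2 ^ k) atTop atTop :=
    tendsto_pow_atTop_atTop_of_one_lt (by norm_num)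
  have e1 := ((tendsto_pow_atTop_atTop_of_one_lt hl1).comp h2k).eventually_gt_atTop (N / V)
  have e2 := ((tendsto_pow_atTop_nhds_zero_of_lt_one hρ0.le hρ1).comp h2k).eventually_le_const
    (show (0 : ℝ) < 1 / 5 by norm_num)
  obtain ⟨k, hk1, hk2⟩ := (e1.and e2).exists
  simp only [Function.comp_apply] at hk1 hk2
  have h3 := (hgrow k).trans (hN _ ⟨by positivity, hk2⟩)
  rw [mul_pow, ← pow_mul, mul_comm 2, pow_mul, ← mul_assoc] at h3
  have h4 := le_of_mul_le_mul_right h3 (by positivity)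
  rw [div_lt_iff₀ hVpos] at hk1
  linarith

theorem integral_mul_rotation_le {d : ℕ} {K : ℝ≥0} {f : EuclideanSpace ℝ (Fin d) → ℝ}
    (hf : LipschitzWith K f) (heven : ∀ x, f (-x) = f x) (h0 : ∫ x, f x ∂stdGauss d = 0)
    {δ : ℝ} (hδ : δ ∈ Set.Ioo 0 (π / 2)) :
    ∫ p, f p.1 * f (cos δ • p.1 + sin δ • p.2) ∂(stdGauss d).prod (stdGauss d) ≤
      cos δ ^ 2 * ∫ x, f x ^ 2 ∂stdGauss d := by
  obtain ⟨N, hN⟩ := exists_integral_mul_ouMean_le hf heven h0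
  have hcos0 : 0 < cos δ := cos_pos_of_mem_Ioo ⟨by linarith [hδ.1, pi_pos], hδ.2⟩
  have hsin0 : 0 < sin δ := sin_pos_of_pos_of_lt_pi hδ.1 (by linarith [hδ.2, pi_pos])
  have hcos1 : cos δ < 1 := by nlinarith [sin_sq_add_cos_sq δ]
  have hsin : √(1 - cos δ ^ 2) = sin δ := by
    rw [← sin_sq, Real.sqrt_sq hsin0.le]
  have h := le_sq_mul_of_sq_le_mul_comp_sq
    (T := fun r => ∫ x, f x * ouMean f r √(1 - r ^ 2) x ∂stdGauss d)
    (integral_nonneg fun x => sq_nonneg (f x))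
    (fun c hc => sq_integral_mul_ouMean_le hf hc) hN ⟨hcos0, hcos1⟩
  rw [← integral_mul_ouMean hf hf]
  simpa only [hsin] using h

/-- The Gaussian Poincaré inequality for even functions, with the improved constant `1 / 2`. -/
theorem integral_sq_le_of_even {d : ℕ} {K : ℝ≥0} {f : EuclideanSpace ℝ (Fin d) → ℝ}
    (hf : LipschitzWith K f) (heven : ∀ x, f (-x) = f x) (h0 : ∫ x, f x ∂stdGauss d = 0) :
    ∫ x, f x ^ 2 ∂stdGauss d ≤ 1 / 2 * ∫ x, ‖fderiv ℝ f x‖ ^ 2 ∂stdGauss d := by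
  have hfc := hf.continuous
  set V := ∫ x, f x ^ 2 ∂stdGauss d with hV
  have hlim := tendsto_integral_rotation_slope hf (F := fun t => t ^ 2) (by fun_prop)
    (A := 2) (by norm_num) zero_le_one (fun t => by
      have := quadratic_le_exp_of_nonneg (abs_nonneg t)
      rw [sq_abs] at this
      rw [abs_of_nonneg (sq_nonneg t), one_mul]
      linarith [abs_nonneg t])
  simp only [integral_sq_strongDual_stdGauss] at hlim
  have hsin : Tendsto (fun δ : ℝ => (sin δ / δ) ^ 2 * V) (𝓝[>] 0) (𝓝 (1 ^ 2 * V)) := by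
    have h := (hasDerivAt_sin 0).tendsto_slope_zero_right
    simp only [zero_add, sin_zero, sub_zero, cos_zero, smul_eq_mul, ← div_eq_inv_mul] at h
    exact (h.pow 2).mul_const V
  rw [one_pow, one_mul] at hsin
  refine le_of_tendsto_of_tendsto hsin (hlim.const_mul (1 / 2)) ?_
  filter_upwards [Ioo_mem_nhdsGT (show (0 : ℝ) < π / 2 by positivity)] with δ hδ
  have hδ0 : 0 < δ := hδ.1
  have hcorr := integral_mul_rotation_le hf heven h0 hδ
  have hm1 := memLp_comp_smul_add_smul hf 1 0 (p := 2) (by simp)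
  simp only [one_smul, zero_smul, add_zero] at hm1
  have hm2 := memLp_comp_smul_add_smul hf (cos δ) (sin δ) (p := 2) (by simp)
  have hV1 : ∫ p, f p.1 ^ 2 ∂(stdGauss d).prod (stdGauss d) = V := by
    rw [integral_fun_fst (fun x => f x ^ 2)]
    simp [hV]
  have hV2 : ∫ p, f (cos δ • p.1 + sin δ • p.2) ^ 2 ∂(stdGauss d).prod (stdGauss d) = V := by
    rw [← hV1, ← integral_comp_rotation δ (g := fun p => f p.1 ^ 2) (by fun_prop)]
    rfl
  have hm12 : Integrable (fun p => f p.1 * f (cos δ • p.1 + sin δ • p.2))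
    ((stdGauss d).prod (stdGauss d)) := hm1.integrable_mul hm2
  have hexp : ∫ p, ((f (cos δ • p.1 + sin δ • p.2) - f p.1) / δ) ^ 2
        ∂(stdGauss d).prod (stdGauss d) =
      (V + V - 2 * ∫ p, f p.1 * f (cos δ • p.1 + sin δ • p.2)
        ∂(stdGauss d).prod (stdGauss d)) / δ ^ 2 := by
    nth_rw 1 [← hV1]
    rw [← hV2, ← integral_const_mul, ← integral_add hm1.integrable_sq hm2.integrable_sq,
      ← integral_sub _ (hm12.const_mul 2), ← integral_div]
    · refine integral_congr_ae (.of_forall fun p => ?_)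
      dsimp only
      ring
    · exact hm1.integrable_sq.add hm2.integrable_sq
  rw [hexp, div_pow, div_mul_eq_mul_div, ← mul_div_assoc]
  refine div_le_div_of_nonneg_right ?_ (sq_nonneg δ)
  rw [sin_sq]
  linarith

/-- At a point of differentiability, a semiconcave function lies below its quadratic expansion. -/
theorem le_add_fderiv_add_sq {E : Type*} [NormedAddCommGroup E] [NormedSpace ℝ E] {f : E → ℝ}
    {A : ℝ} (hA : 0 ≤ A) (hf : ∀ x h : E, f (x + h) + f (x - h) - 2 * f x ≤ A * ‖h‖ ^ 2) {x : E}
    (hx : DifferentiableAt ℝ f x) (h : E) :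
    f (x + h) ≤ f x + fderiv ℝ f x h + A / 2 * ‖h‖ ^ 2 := by
  have hstep : ∀ n : ℕ, f (x + h) - f x ≤
      2 ^ n * (f (x + (1 / 2 : ℝ) ^ n • h) - f x) + A / 2 * ‖h‖ ^ 2 * (1 - (1 / 2) ^ n) := by
    intro n
    induction n with
    | zero => simp
    | succ n ih =>
      have h1 := hf (x + (1 / 2 : ℝ) ^ (n + 1) • h) ((1 / 2 : ℝ) ^ (n + 1) • h)
      have e1 : x + (1 / 2 : ℝ) ^ (n + 1) • h + (1 / 2 : ℝ) ^ (n + 1) • h =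
          x + (1 / 2 : ℝ) ^ n • h := by rw [pow_succ]; module
      rw [e1, add_sub_cancel_right, norm_smul, Real.norm_of_nonneg (by positivity)] at h1
      have h2 : (2 : ℝ) ^ n * (1 / 2) ^ n = 1 := by rw [← mul_pow]; norm_num
      have h3 := mul_le_mul_of_nonneg_left h1 (show (0 : ℝ) ≤ 2 ^ n by positivity)
      have h4 : (2 : ℝ) ^ n * (A * ((1 / 2) ^ (n + 1) * ‖h‖) ^ 2) =
          A / 4 * ‖h‖ ^ 2 * (1 / 2) ^ n := by
        calc _ = (2 ^ n * (1 / 2) ^ n) * (A / 4 * ‖h‖ ^ 2 * (1 / 2) ^ n) := by ring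
          _ = _ := by rw [h2, one_mul]
      rw [h4] at h3
      calc _ ≤ _ := ih
        _ ≤ _ := by
          rw [pow_succ (2 : ℝ) n, pow_succ (1 / 2 : ℝ) n] at *
          linarith
  have hline : HasDerivAt (fun t : ℝ => x + t • h) h 0 := by
    simpa using ((hasDerivAt_id (0 : ℝ)).smul_const h).const_add x
  have hx' : HasFDerivAt f (fderiv ℝ f x) (x + (0 : ℝ) • h) := by simpa using hx.hasFDerivAt
  have hder := (hx'.comp_hasDerivAt (0 : ℝ) hline).tendsto_slope_zero_right
  have hhalf : Tendsto (fun n : ℕ => (1 / 2 : ℝ) ^ n) atTop (𝓝[>] 0) :=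
    tendsto_nhdsWithin_iff.2 ⟨tendsto_pow_atTop_nhds_zero_of_lt_one (by norm_num) (by norm_num),
      .of_forall fun n => Set.mem_Ioi.2 (by positivity)⟩
  have hlim : Tendsto (fun n : ℕ => 2 ^ n * (f (x + (1 / 2 : ℝ) ^ n • h) - f x) +
      A / 2 * ‖h‖ ^ 2) atTop (𝓝 (fderiv ℝ f x h + A / 2 * ‖h‖ ^ 2)) := by
    refine ((hder.comp hhalf).congr fun n => ?_).add_const _
    simp
  have hle := ge_of_tendsto' hlim fun n => (hstep n).trans (by
    have : 0 ≤ A / 2 * ‖h‖ ^ 2 * (1 / 2) ^ n := by positivity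
    linarith)
  linarith

theorem Hconv_le_s2 {d : ℕ} {K : ℝ≥0} {f : EuclideanSpace ℝ (Fin d) → ℝ} (hf : LipschitzWith K f)
    {A : ℝ} (hA : 0 ≤ A)
    (hconc : ∀ x h, f (x + h) + f (x - h) - 2 * f x ≤ A * ‖h‖ ^ 2)
    {x : EuclideanSpace ℝ (Fin d)} (hx : DifferentiableAt ℝ f x) :
    Hconv f x ≤ f x - ‖fderiv ℝ f x‖ ^ 2 / 2 + A / 2 * K ^ 2 := by
  have hbdd : BddBelow (Set.range fun y => f (x + y) + ‖y‖ ^ 2 / 2) := by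
    refine ⟨f x - K ^ 2 / 2, ?_⟩
    rintro _ ⟨y, rfl⟩
    have h1 := (neg_le_abs _).trans (hf.dist_le_mul (x + y) x)
    rw [dist_eq_norm, add_sub_cancel_left] at h1
    dsimp only
    nlinarith [sq_nonneg ((K : ℝ) - ‖y‖)]
  set v := (InnerProductSpace.toDual ℝ (EuclideanSpace ℝ (Fin d))).symm (fderiv ℝ f x) with hv
  have hnorm : ‖v‖ = ‖fderiv ℝ f x‖ := LinearIsometryEquiv.norm_map _ _
  have happ : fderiv ℝ f x v = ‖v‖ ^ 2 := by
    rw [← real_inner_self_eq_norm_sq]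
    exact (InnerProductSpace.toDual_symm_apply).symm
  have h1 := ciInf_le hbdd (-v)
  have h2 := le_add_fderiv_add_sq hA hconc hx (-v)
  rw [map_neg, happ, norm_neg] at h2
  have h3 : A / 2 * ‖v‖ ^ 2 ≤ A / 2 * K ^ 2 := by
    have := norm_fderiv_le_of_lipschitz ℝ hf (x₀ := x)
    rw [hnorm]
    gcongr
  rw [norm_neg] at h1
  rw [← hnorm]
  refine h1.trans ?_
  linarith

theorem Real.abs_exp_sub_quadratic_le_cube_mul_exp (u : ℝ) :
    |exp u - 1 - u - u ^ 2 / 2| ≤ |u| ^ 3 * exp |u| := by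
  have h := Complex.norm_exp_sub_sum_le_norm_mul_exp (u : ℂ) 3
  have e : Complex.exp (u : ℂ) - ∑ m ∈ Finset.range 3, (u : ℂ) ^ m / (m.factorial : ℂ) =
      ((exp u - 1 - u - u ^ 2 / 2 : ℝ) : ℂ) := by
    simp [Finset.sum_range_succ]
    ring
  rwa [e, Complex.norm_real, Complex.norm_real, Real.norm_eq_abs, Real.norm_eq_abs] at h

section ExponentialWeight

variable {L : ℝ} (u : ℝ)

theorem exp_abs_le_exp_weight (hL : 0 < L) : exp |u| ≤ exp ((1 + 1 / L) * |u|) := by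
  refine exp_le_exp.2 ?_
  have : 0 ≤ 1 / L * |u| := by positivity
  linarith

theorem abs_le_mul_exp_weight (hL : 0 < L) : |u| ≤ L * exp ((1 + 1 / L) * |u|) := by
  have h1 := add_one_le_exp ((1 + 1 / L) * |u|)
  have h2 := mul_le_mul_of_nonneg_left h1 hL.le
  have h3 : L * ((1 + 1 / L) * |u| + 1) = L * |u| + |u| + L := by field_simp
  have : 0 ≤ L * |u| := by positivity
  linarith

theorem abs_exp_sub_quadratic_le_exp_weight (hL : 0 < L) :
    |exp u - 1 - u - u ^ 2 / 2| ≤ 6 * L ^ 3 * exp ((1 + 1 / L) * |u|) := by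
  refine (Real.abs_exp_sub_quadratic_le_cube_mul_exp u).trans ?_
  have h1 := pow_div_factorial_le_exp (|u| / L) (by positivity) 3
  have h2 : |u| ^ 3 ≤ 6 * L ^ 3 * exp (|u| / L) := by
    rw [div_pow, div_div, div_le_iff₀ (by positivity)] at h1
    norm_num [Nat.factorial] at h1
    linarith
  calc |u| ^ 3 * exp |u| ≤ 6 * L ^ 3 * exp (|u| / L) * exp |u| := by gcongr
    _ = _ := by rw [mul_assoc, ← exp_add]; congr 2; ring

theorem exp_sub_le_exp_weight (hL : 0 < L) {w : ℝ} (hw0 : 0 ≤ w) (hw : w ≤ L ^ 2 / 2) :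
    exp (u - w) ≤ 1 + u + u ^ 2 / 2 - w +
      (13 / 2 + L / 8) * L ^ 3 * exp ((1 + 1 / L) * |u|) := by
  set P := exp ((1 + 1 / L) * |u|) with hP
  have hP0 : 0 < P := exp_pos _
  have hquad : exp (-w) ≤ 1 - w + w ^ 2 / 2 := by
    have h1 := quadratic_le_exp_of_nonneg hw0
    have h2 : exp (-w) * exp w = 1 := by rw [← exp_add]; simp
    have h3 : 0 < exp (-w) := exp_pos _
    have h4 : 0 ≤ 1 - w + w ^ 2 / 2 := by nlinarith [sq_nonneg (w - 1)]
    have h5 := mul_le_mul_of_nonneg_left h1 h4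
    have h6 : 1 ≤ (1 - w + w ^ 2 / 2) * exp w := by nlinarith [sq_nonneg (w ^ 2)]
    have h7 := mul_le_mul_of_nonneg_left h6 h3.le
    nlinarith
  have hu := (abs_le.1 (abs_exp_sub_quadratic_le_exp_weight u hL)).2
  have h1 : -(u * w) ≤ L ^ 3 / 2 * P := by
    have := abs_le_mul_exp_weight u hL
    calc -(u * w) = -u * w := by ring
      _ ≤ |u| * w := by gcongr; exact neg_le_abs u
      _ ≤ (L * P) * (L ^ 2 / 2) := by gcongr
      _ = _ := by ring
  have h2 : exp u * (w ^ 2 / 2) ≤ L ^ 4 / 8 * P := by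
    calc exp u * (w ^ 2 / 2) ≤ P * ((L ^ 2 / 2) ^ 2 / 2) := by
          gcongr
          exact (exp_le_exp.2 (le_abs_self u)).trans (exp_abs_le_exp_weight u hL)
      _ = _ := by ring
  have h3 : w * (u + 1) ≤ w * exp u := by gcongr; exact add_one_le_exp u
  calc exp (u - w) = exp u * exp (-w) := by rw [sub_eq_add_neg, exp_add]
    _ ≤ exp u * (1 - w + w ^ 2 / 2) := by gcongr
    _ ≤ _ := by linarith

end ExponentialWeight

section MeanZero

variable {d : ℕ} {K : ℝ≥0} {g : EuclideanSpace ℝ (Fin d) → ℝ}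

theorem integrable_exp_weight (hg : LipschitzWith K g) :
    Integrable (fun x => exp ((1 + 1 / (K : ℝ)) * |g x|)) (stdGauss d) := by
  have h : LipschitzWith ((1 + 1 / K) * (1 * K)) fun x => (1 + 1 / (K : ℝ)) * |g x| := by
    have h1 : LipschitzWith (1 * K) fun x => |g x| := lipschitzWith_one_norm.comp hg
    have h2 : LipschitzWith (1 + 1 / K) fun t : ℝ => (1 + 1 / (K : ℝ)) * t := by
      refine LipschitzWith.of_dist_le_mul fun s t => ?_
      rw [Real.dist_eq, Real.dist_eq, ← mul_sub, abs_mul, abs_of_nonneg (by positivity)]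
      simp
    exact h2.comp h1
  exact integrable_exp_of_lipschitz h

theorem integral_exp_weight_le (hg : LipschitzWith K g) (hK : 0 < K)
    (h0 : ∫ x, g x ∂stdGauss d = 0) :
    ∫ x, exp ((1 + 1 / (K : ℝ)) * |g x|) ∂stdGauss d ≤ 2 * exp (π ^ 2 / 8 * (K + 1) ^ 2) := by
  have hK' : (0 : ℝ) < K := hK
  have hlip : ∀ s : ℝ, |s| = 1 + 1 / (K : ℝ) → LipschitzWith (K + 1) fun x => s * g x := by
    intro s hs
    refine LipschitzWith.of_dist_le_mul fun x y => ?_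
    have h1 := hg.dist_le_mul x y
    rw [Real.dist_eq] at h1 ⊢
    rw [← mul_sub, abs_mul, hs]
    calc _ ≤ (1 + 1 / (K : ℝ)) * (K * dist x y) := by gcongr
      _ = _ := by push_cast; field_simp
  have hs1 := hlip (1 + 1 / K) (abs_of_nonneg (by positivity))
  have hs2 := hlip (-(1 + 1 / K)) (by rw [abs_neg]; exact abs_of_nonneg (by positivity))
  have b1 := integral_exp_le_of_integral_eq_zero hs1 (by rw [integral_const_mul, h0, mul_zero])
  have b2 := integral_exp_le_of_integral_eq_zero hs2 (by rw [integral_const_mul, h0, mul_zero])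
  have i1 := integrable_exp_of_lipschitz hs1
  have i2 := integrable_exp_of_lipschitz hs2
  push_cast at b1 b2
  calc _ ≤ ∫ x, (exp ((1 + 1 / (K : ℝ)) * g x) + exp (-(1 + 1 / (K : ℝ)) * g x)) ∂stdGauss d := by
        refine integral_mono (integrable_exp_weight hg) (i1.add i2) fun x => ?_
        dsimp only
        rcases abs_cases (g x) with ⟨h, -⟩ | ⟨h, -⟩
        · rw [h]; linarith [exp_pos (-(1 + 1 / (K : ℝ)) * g x)]
        · rw [h, mul_neg, ← neg_mul]; linarith [exp_pos ((1 + 1 / (K : ℝ)) * g x)]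
    _ ≤ _ := by rw [integral_add i1 i2]; linarith

theorem integral_exp_neg_le (hg : LipschitzWith K g) (hK : 0 < K)
    (h0 : ∫ x, g x ∂stdGauss d = 0) :
    ∫ x, exp (-g x) ∂stdGauss d ≤ 1 + (∫ x, g x ^ 2 ∂stdGauss d) / 2 +
      6 * K ^ 3 * (2 * exp (π ^ 2 / 8 * (K + 1) ^ 2)) := by
  have hi : Integrable g (stdGauss d) :=
    memLp_one_iff_integrable.1 (hg.memLp_of_isGaussian (by simp))
  have hi2 : Integrable (fun x => g x ^ 2) (stdGauss d) :=
    (hg.memLp_of_isGaussian (p := 2) (by simp)).integrable_sq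
  have hw := integrable_exp_weight hg
  have i1 : Integrable (fun x => 1 - g x) (stdGauss d) := (integrable_const 1).sub hi
  have i2 : Integrable (fun x => 1 - g x + g x ^ 2 / 2) (stdGauss d) := i1.add (hi2.div_const 2)
  calc _ ≤ ∫ x, (1 - g x + g x ^ 2 / 2 + 6 * K ^ 3 * exp ((1 + 1 / (K : ℝ)) * |g x|))
        ∂stdGauss d := by
        refine integral_mono (integrable_exp_of_lipschitz hg.neg) (i2.add (hw.const_mul _))
          fun x => ?_
        have h := (abs_le.1 (abs_exp_sub_quadratic_le_exp_weight (-g x)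
          (NNReal.coe_pos.2 hK))).2
        rw [abs_neg, neg_sq] at h
        dsimp only
        linarith
    _ = 1 + (∫ x, g x ^ 2 ∂stdGauss d) / 2 +
        6 * K ^ 3 * ∫ x, exp ((1 + 1 / (K : ℝ)) * |g x|) ∂stdGauss d := by
        rw [integral_add i2 (hw.const_mul _), integral_add i1 (hi2.div_const 2),
          integral_sub (integrable_const 1) hi, h0, integral_div, integral_const_mul]
        simp
    _ ≤ _ := by gcongr; exact integral_exp_weight_le hg hK h0

theorem norm_fderiv_sq_half_le (hg : LipschitzWith K g) (x : EuclideanSpace ℝ (Fin d)) :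
    ‖fderiv ℝ g x‖ ^ 2 / 2 ≤ (K : ℝ) ^ 2 / 2 := by
  have := norm_fderiv_le_of_lipschitz ℝ hg (x₀ := x)
  gcongr

theorem integrable_norm_fderiv_sq_half (hg : LipschitzWith K g) :
    Integrable (fun x => ‖fderiv ℝ g x‖ ^ 2 / 2) (stdGauss d) := by
  refine Integrable.of_bound (C := (K : ℝ) ^ 2 / 2)
    (((measurable_fderiv ℝ g).norm.pow_const 2).div_const 2).aestronglyMeasurable
    (.of_forall fun x => ?_)
  rw [Real.norm_of_nonneg (by positivity)]
  exact norm_fderiv_sq_half_le hg x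

theorem integrable_exp_sub_norm_fderiv_sq_half (hg : LipschitzWith K g) :
    Integrable (fun x => exp (g x - ‖fderiv ℝ g x‖ ^ 2 / 2)) (stdGauss d) := by
  refine (integrable_exp_of_lipschitz hg).mono' ?_ (.of_forall fun x => ?_)
  · exact (hg.continuous.measurable.sub
      (((measurable_fderiv ℝ g).norm.pow_const 2).div_const 2)).exp.aestronglyMeasurable
  · rw [Real.norm_of_nonneg (exp_pos _).le]
    exact exp_le_exp.2 (by linarith [show 0 ≤ ‖fderiv ℝ g x‖ ^ 2 / 2 by positivity])

theorem integral_exp_sub_le_of_integral_sq_le (hg : LipschitzWith K g) (hK : 0 < K)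
    (h0 : ∫ x, g x ∂stdGauss d = 0) {w : EuclideanSpace ℝ (Fin d) → ℝ}
    (hw : Integrable w (stdGauss d)) (hw0 : ∀ x, 0 ≤ w x) (hwK : ∀ x, w x ≤ (K : ℝ) ^ 2 / 2)
    (hexp : Integrable (fun x => exp (g x - w x)) (stdGauss d))
    (hle : ∫ x, g x ^ 2 ∂stdGauss d ≤ ∫ x, w x ∂stdGauss d) :
    ∫ x, exp (g x - w x) ∂stdGauss d ≤ 1 - (∫ x, g x ^ 2 ∂stdGauss d) / 2 +
      (13 / 2 + K / 8) * K ^ 3 * (2 * exp (π ^ 2 / 8 * (K + 1) ^ 2)) := by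
  have hi : Integrable g (stdGauss d) :=
    memLp_one_iff_integrable.1 (hg.memLp_of_isGaussian (by simp))
  have hi2 : Integrable (fun x => g x ^ 2) (stdGauss d) :=
    (hg.memLp_of_isGaussian (p := 2) (by simp)).integrable_sq
  have hφ := integrable_exp_weight hg
  have i1 : Integrable (fun x => 1 + g x) (stdGauss d) := (integrable_const 1).add hi
  have i2 : Integrable (fun x => 1 + g x + g x ^ 2 / 2) (stdGauss d) := i1.add (hi2.div_const 2)
  have i3 : Integrable (fun x => 1 + g x + g x ^ 2 / 2 - w x) (stdGauss d) := i2.sub hw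
  calc ∫ x, exp (g x - w x) ∂stdGauss d
      ≤ ∫ x, (1 + g x + g x ^ 2 / 2 - w x +
          (13 / 2 + K / 8) * K ^ 3 * exp ((1 + 1 / (K : ℝ)) * |g x|)) ∂stdGauss d := by
        refine integral_mono hexp (i3.add (hφ.const_mul _)) fun x => ?_
        exact exp_sub_le_exp_weight (g x) (NNReal.coe_pos.2 hK) (hw0 x) (hwK x)
    _ = 1 + (∫ x, g x ^ 2 ∂stdGauss d) / 2 - (∫ x, w x ∂stdGauss d) +
        (13 / 2 + K / 8) * K ^ 3 * ∫ x, exp ((1 + 1 / (K : ℝ)) * |g x|) ∂stdGauss d := by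
        rw [integral_add i3 (hφ.const_mul _), integral_sub i2 hw,
          integral_add i1 (hi2.div_const 2),
          integral_add (integrable_const 1) hi, h0, integral_div, integral_const_mul]
        simp
    _ ≤ 1 - (∫ x, g x ^ 2 ∂stdGauss d) / 2 +
        (13 / 2 + K / 8) * K ^ 3 * ∫ x, exp ((1 + 1 / (K : ℝ)) * |g x|) ∂stdGauss d := by
        linarith
    _ ≤ _ := by gcongr; exact integral_exp_weight_le hg hK h0

theorem integral_exp_sub_norm_fderiv_sq_half_le (hg : LipschitzWith K g) (hK : 0 < K)
    (heven : ∀ x, g (-x) = g x) (h0 : ∫ x, g x ∂stdGauss d = 0) :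
    ∫ x, exp (g x - ‖fderiv ℝ g x‖ ^ 2 / 2) ∂stdGauss d ≤
      1 - (∫ x, g x ^ 2 ∂stdGauss d) / 2 +
        (13 / 2 + K / 8) * K ^ 3 * (2 * exp (π ^ 2 / 8 * (K + 1) ^ 2)) := by
  have hpoincare := integral_sq_le_of_even hg heven h0
  refine integral_exp_sub_le_of_integral_sq_le hg hK h0 (integrable_norm_fderiv_sq_half hg)
    (fun x => by positivity) (norm_fderiv_sq_half_le hg)
    (integrable_exp_sub_norm_fderiv_sq_half hg) ?_
  rw [integral_div]
  linarith

end MeanZero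

theorem lintegral_exp_mul_lintegral_exp_Hconv_le {d : ℕ} {K : ℝ≥0} (hK : 0 < K)
    {f : EuclideanSpace ℝ (Fin d) → ℝ} (hf : LipschitzWith K f) (heven : ∀ x, f (-x) = f x)
    {A : ℝ} (hA : 0 ≤ A) (hconc : ∀ x h, f (x + h) + f (x - h) - 2 * f x ≤ A * ‖h‖ ^ 2) :
    (∫⁻ x, ENNReal.ofReal (exp (-f x)) ∂stdGauss d) *
        (∫⁻ x, ENNReal.ofReal (exp (Hconv f x)) ∂stdGauss d) ≤
      ENNReal.ofReal (exp (A / 2 * K ^ 2) *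
        (1 + (13 / 2 + K / 8) * K ^ 3 * (2 * exp (π ^ 2 / 8 * (K + 1) ^ 2))) ^ 2) := by
  set m := ∫ x, f x ∂stdGauss d with hm
  set g : EuclideanSpace ℝ (Fin d) → ℝ := fun x => f x - m with hgdef
  have hg : LipschitzWith K g := LipschitzWith.of_dist_le_mul fun x y => by
    simpa [hgdef] using hf.dist_le_mul x y
  have hfi : Integrable f (stdGauss d) :=
    memLp_one_iff_integrable.1 (hf.memLp_of_isGaussian (by simp))
  have hg0 : ∫ x, g x ∂stdGauss d = 0 := by
    rw [hgdef, integral_sub hfi (integrable_const m), ← hm]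
    simp
  have hgeven : ∀ x, g (-x) = g x := fun x => by simp only [hgdef, heven]
  have hfderiv : ∀ x, fderiv ℝ g x = fderiv ℝ f x := fun x => by
    rw [hgdef, fderiv_sub_const]
  have h1 := integral_exp_neg_le hg hK hg0
  have h2 := integral_exp_sub_norm_fderiv_sq_half_le hg hK hgeven hg0
  set Q := 2 * exp (π ^ 2 / 8 * ((K : ℝ) + 1) ^ 2)
  have hQ : 0 < Q := by positivity
  set V := ∫ x, g x ^ 2 ∂stdGauss d
  set a := ∫ x, exp (-g x) ∂stdGauss d
  set b := ∫ x, exp (g x - ‖fderiv ℝ g x‖ ^ 2 / 2) ∂stdGauss d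
  have ha0 : 0 ≤ a := integral_nonneg fun x => (exp_pos _).le
  have hb0 : 0 ≤ b := integral_nonneg fun x => (exp_pos _).le
  have hleft : ∫⁻ x, ENNReal.ofReal (exp (-f x)) ∂stdGauss d = ENNReal.ofReal (exp (-m) * a) := by
    have hi : Integrable (fun x => exp (-g x)) (stdGauss d) := integrable_exp_of_lipschitz hg.neg
    rw [← integral_const_mul, ofReal_integral_eq_lintegral_ofReal (hi.const_mul _)
      (.of_forall fun x => by positivity)]
    refine lintegral_congr fun x => ?_
    rw [← exp_add]
    congr 2
    simp only [hgdef]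
    ring
  have hright : ∫⁻ x, ENNReal.ofReal (exp (Hconv f x)) ∂stdGauss d ≤
      ENNReal.ofReal (exp (m + A / 2 * K ^ 2) * b) := by
    rw [← integral_const_mul, ofReal_integral_eq_lintegral_ofReal
      ((integrable_exp_sub_norm_fderiv_sq_half hg).const_mul _)
      (.of_forall fun x => by positivity)]
    refine lintegral_mono_ae ?_
    filter_upwards [ae_differentiableAt_stdGauss hf] with x hx
    refine ENNReal.ofReal_le_ofReal ?_
    rw [← exp_add, exp_le_exp, hfderiv]
    have := Hconv_le_s2 hf hA hconc hx
    simp only [hgdef]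
    linarith
  calc _ ≤ ENNReal.ofReal (exp (-m) * a) * ENNReal.ofReal (exp (m + A / 2 * K ^ 2) * b) := by
        rw [hleft]; gcongr
    _ = ENNReal.ofReal (exp (A / 2 * K ^ 2) * (a * b)) := by
        rw [← ENNReal.ofReal_mul (by positivity)]
        congr 1
        calc _ = exp (-m) * exp (m + A / 2 * K ^ 2) * (a * b) := by ring
          _ = _ := by rw [← exp_add, neg_add_cancel_left]
    _ ≤ _ := by
        refine ENNReal.ofReal_le_ofReal (mul_le_mul_of_nonneg_left ?_ (exp_pos _).le)
        set R := (13 / 2 + (K : ℝ) / 8) * K ^ 3 * Q with hRdef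
        have hR : 6 * (K : ℝ) ^ 3 * Q ≤ R := by
          have : 0 ≤ (1 / 2 + (K : ℝ) / 8) * K ^ 3 * Q := by positivity
          rw [hRdef]
          linarith
        have h1' : a ≤ 1 + R + V / 2 := by linarith
        have h2' : b ≤ 1 + R - V / 2 := by linarith
        have hpos : 0 ≤ 1 + R + V / 2 := ha0.trans h1'
        calc a * b ≤ (1 + R + V / 2) * (1 + R - V / 2) := mul_le_mul h1' h2' hb0 hpos
          _ ≤ _ := by nlinarith [sq_nonneg V]

/-- The "small ε" inequality: for every `C > 0` there is a constant `K` depending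
only on `C` such that for every `ε ∈ (0,1]` and every even `f ∈ F(C,ε)`,
`E[e^{-f(X)}] E[e^{Hf(X)}] ≤ 1 + K ε³`. -/
theorem small_epsilon_inequality (C : ℝ) (hC : 0 < C) :
    ∃ K : ℝ, ∀ (d : ℕ) (ε : ℝ), ε ∈ Set.Ioc (0 : ℝ) 1 →
      ∀ f : EuclideanSpace ℝ (Fin d) → ℝ, memF C ε f → (∀ x, f (-x) = f x) →
        (∫⁻ x, ENNReal.ofReal (Real.exp (-f x)) ∂stdGauss d) *
          (∫⁻ x, ENNReal.ofReal (Real.exp (Hconv f x)) ∂stdGauss d) ≤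
          ENNReal.ofReal (1 + K * ε ^ 3) := by
  set κ := (13 / 2 + C / 8) * C ^ 3 * (2 * exp (π ^ 2 / 8 * (C + 1) ^ 2)) with hκ
  set τ := C ^ 3 / 2 * exp (C ^ 3 / 2) with hτ
  have hκ0 : 0 < κ := by positivity
  have hτ0 : 0 < τ := by positivity
  refine ⟨τ + (2 * κ + κ ^ 2) + τ * (2 * κ + κ ^ 2), fun d ε hε f hf heven => ?_⟩
  obtain ⟨hε0, hε1⟩ := hε
  have hL : 0 < C * ε := by positivity
  have hLC : C * ε ≤ C := mul_le_of_le_one_right hC.le hε1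
  have h := lintegral_exp_mul_lintegral_exp_Hconv_le (Real.toNNReal_pos.2 hL) hf.1 heven
    (A := C * ε ^ 2) (by positivity) hf.2
  rw [Real.coe_toNNReal _ hL.le] at h
  refine h.trans (ENNReal.ofReal_le_ofReal ?_)
  have hε3 : ε ^ 3 ≤ 1 := pow_le_one₀ hε0.le hε1
  have hε4 : ε ^ 4 ≤ ε ^ 3 := pow_le_pow_of_le_one hε0.le hε1 (by norm_num)
  have hε30 : 0 < ε ^ 3 := by positivity
  have hfac : (13 / 2 + C * ε / 8) * (C * ε) ^ 3 * (2 * exp (π ^ 2 / 8 * (C * ε + 1) ^ 2)) ≤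
      κ * ε ^ 3 := by
    calc _ ≤ (13 / 2 + C / 8) * (C * ε) ^ 3 * (2 * exp (π ^ 2 / 8 * (C + 1) ^ 2)) := by gcongr
      _ = _ := by rw [hκ]; ring
  have hsq : (1 + (13 / 2 + C * ε / 8) * (C * ε) ^ 3 *
      (2 * exp (π ^ 2 / 8 * (C * ε + 1) ^ 2))) ^ 2 ≤ 1 + (2 * κ + κ ^ 2) * ε ^ 3 := by
    calc _ ≤ (1 + κ * ε ^ 3) ^ 2 := by gcongr
      _ = 1 + 2 * κ * ε ^ 3 + κ ^ 2 * ε ^ 3 * ε ^ 3 := by ring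
      _ ≤ 1 + 2 * κ * ε ^ 3 + κ ^ 2 * ε ^ 3 * 1 := by gcongr
      _ = _ := by ring
  have hexp : exp (C * ε ^ 2 / 2 * (C * ε) ^ 2) ≤ 1 + τ * ε ^ 3 := by
    have e1 : C * ε ^ 2 / 2 * (C * ε) ^ 2 = C ^ 3 / 2 * ε ^ 4 := by ring
    have e2 : C ^ 3 / 2 * ε ^ 4 ≤ C ^ 3 / 2 * ε ^ 3 := by gcongr
    have e3 : C ^ 3 / 2 * ε ^ 3 ≤ C ^ 3 / 2 := mul_le_of_le_one_right (by positivity) hε3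
    rw [e1]
    set c := C ^ 3 / 2 * ε ^ 4
    have e4 : exp c * (1 - c) ≤ 1 := by
      calc exp c * (1 - c) ≤ exp c * exp (-c) := by
            gcongr
            linarith [add_one_le_exp (-c)]
        _ = 1 := by rw [← exp_add, add_neg_cancel, exp_zero]
    have e5 : c * exp c ≤ C ^ 3 / 2 * ε ^ 3 * exp (C ^ 3 / 2) := by
      gcongr
      linarith
    rw [hτ]
    linarith
  calc _ ≤ (1 + τ * ε ^ 3) * (1 + (2 * κ + κ ^ 2) * ε ^ 3) := by gcongr
    _ = 1 + (τ + (2 * κ + κ ^ 2)) * ε ^ 3 + τ * (2 * κ + κ ^ 2) * ε ^ 3 * ε ^ 3 := by ring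
    _ ≤ 1 + (τ + (2 * κ + κ ^ 2)) * ε ^ 3 + τ * (2 * κ + κ ^ 2) * ε ^ 3 * 1 := by gcongr
    _ = _ := by ring
end

section
/- Let E₁, E₂ be finite-dimensional Euclidean spaces with standard Gaussian measures γ₁, γ₂, and let g : E₁ × E₂ → ℝ be continuous, even (g(−x,−y) = g(x,y)) and bounded from below. Then ∫_{E₁×E₂} e^{Hg} d(γ₁ ⊗ γ₂) ≤ ∫_{E₁×E₂} e^{H S₂ g} d(γ₁ ⊗ γ₂). -/
open MeasureTheory Real

/-- The standard Gaussian probability measure on a finite-dimensional Euclidean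
space `E`, given by its density `(2π)^{-dim E/2} e^{-|x|²/2}`. -/
noncomputable def gaussOf (E : Type*) [NormedAddCommGroup E] [InnerProductSpace ℝ E]
    [FiniteDimensional ℝ E] [MeasurableSpace E] [BorelSpace E] : Measure E :=
  volume.withDensity fun x =>
    ENNReal.ofReal ((2 * π) ^ (-(Module.finrank ℝ E : ℝ) / 2) * Real.exp (-‖x‖ ^ 2 / 2))

/-- The infimum convolution with the Euclidean quadratic cost on `E₁ × E₂`:
`Hg(x,y) = inf_{u,v} ( g(x+u, y+v) + ½|u|² + ½|v|² )`. -/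
noncomputable def H2 {E₁ E₂ : Type*} [NormedAddCommGroup E₁] [NormedAddCommGroup E₂]
    (g : E₁ → E₂ → ℝ) (x : E₁) (y : E₂) : ℝ :=
  ⨅ p : E₁ × E₂, (g (x + p.1) (y + p.2) + ‖p.1‖ ^ 2 / 2 + ‖p.2‖ ^ 2 / 2)

/-- The partial symmetrisation in the second variable:
`S₂g(x,y) = inf_v ( ½(g(x, v+y) + g(x, v−y)) + ½|v|² )`. -/
noncomputable def S2 {E₁ E₂ : Type*} [NormedAddCommGroup E₂]
    (g : E₁ → E₂ → ℝ) (x : E₁) (y : E₂) : ℝ :=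
  ⨅ v : E₂, ((g x (v + y) + g x (v - y)) / 2 + ‖v‖ ^ 2 / 2)

open scoped ENNReal Pointwise

theorem volume_add_volume_le_of_isCompact {K L D : Set ℝ} (hK : IsCompact K) (hL : IsCompact L)
    (hKne : K.Nonempty) (hLne : L.Nonempty) (hD : ∀ x ∈ K, ∀ y ∈ L, x + y ∈ D) :
    volume K + volume L ≤ volume D := by
  have ha := hK.sSup_mem hKne
  have hb := hL.sInf_mem hLne
  set a := sSup K
  set b := sInf L
  have hdisj : AEDisjoint volume ((fun x => x + b) '' K) ((fun y => a + y) '' L) := by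
    refine measure_mono_null (t := {a + b}) ?_ (by simp)
    rintro _ ⟨⟨x, hx, rfl⟩, y, hy, hxy⟩
    have hxa : x ≤ a := le_csSup hK.bddAbove hx
    have hby : b ≤ y := csInf_le hL.bddBelow hy
    simp only [Set.mem_singleton_iff] at *
    linarith
  have hmeas : MeasurableSet ((fun y => a + y) '' L) :=
    (hL.image (by fun_prop)).measurableSet
  calc volume K + volume L
      = volume ((fun x => x + b) '' K) + volume ((fun y => a + y) '' L) := by
        simp
    _ = volume ((fun x => x + b) '' K ∪ (fun y => a + y) '' L) :=
        (measure_union₀ hmeas.nullMeasurableSet hdisj).symm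
    _ ≤ volume D := by
        refine measure_mono ?_
        rintro _ (⟨x, hx, rfl⟩ | ⟨y, hy, rfl⟩)
        · exact hD x hx b hb
        · exact hD a ha y hy

/-- The Brunn–Minkowski inequality on the real line. -/
theorem volume_add_volume_le {A B D : Set ℝ} (hA : MeasurableSet A) (hB : MeasurableSet B)
    (hAne : A.Nonempty) (hBne : B.Nonempty) (hD : ∀ x ∈ A, ∀ y ∈ B, x + y ∈ D) :
    volume A + volume B ≤ volume D := by
  obtain ⟨a, ha⟩ := hAne
  obtain ⟨b, hb⟩ := hBne
  rw [hA.measure_eq_iSup_isCompact, hB.measure_eq_iSup_isCompact]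
  simp only [iSup_and']
  refine ENNReal.biSup_add_biSup_le' ⟨∅, by simp⟩ ⟨∅, by simp⟩ fun K hK L hL => ?_
  calc volume K + volume L ≤ volume (insert a K) + volume (insert b L) :=
        add_le_add (measure_mono (Set.subset_insert _ _)) (measure_mono (Set.subset_insert _ _))
    _ ≤ volume D := volume_add_volume_le_of_isCompact (hK.2.insert a) (hL.2.insert b)
        (Set.insert_nonempty _ _) (Set.insert_nonempty _ _) fun x hx y hy =>
          hD x (Set.insert_subset ha hK.1 hx) y (Set.insert_subset hb hL.1 hy)

theorem volume_add_volume_le_two_mul {A B C : Set ℝ} (hA : MeasurableSet A) (hB : MeasurableSet B)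
    (hAne : A.Nonempty) (hBne : B.Nonempty)
    (hC : ∀ x ∈ A, ∀ y ∈ B, (1 / 2 : ℝ) • (x + y) ∈ C) :
    volume A + volume B ≤ 2 * volume C := by
  have h := volume_add_volume_le (D := (2 : ℝ) • C) hA hB hAne hBne fun x hx y hy =>
    ⟨_, hC x hx y hy, by simp⟩
  simpa [Measure.addHaar_smul] using h

/-- The layer cake formula for functions bounded by `1`. -/
theorem lintegral_eq_lintegral_volume_lt {f : ℝ → ℝ≥0∞} (hf : Measurable f) (hf1 : ∀ x, f x ≤ 1) :
    ∫⁻ x, f x = ∫⁻ t in Set.Ioo (0 : ℝ) 1, volume {x | ENNReal.ofReal t < f x} := by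
  have hfin : ∀ x, f x ≠ ∞ := fun x => ((hf1 x).trans_lt ENNReal.one_lt_top).ne
  have key := lintegral_eq_lintegral_meas_lt volume (f := fun x => (f x).toReal)
    (Filter.Eventually.of_forall fun x => ENNReal.toReal_nonneg) hf.ennreal_toReal.aemeasurable
  simp only [ENNReal.ofReal_toReal (hfin _)] at key
  rw [key, ← Set.Ioo_union_Ici_eq_Ioi (zero_lt_one' ℝ),
    lintegral_union measurableSet_Ici (by
      exact Set.disjoint_left.2 fun t ht ht' => absurd ht.2 (not_lt.2 ht'))]
  have h0 : ∫⁻ t in Set.Ici (1 : ℝ), volume {x | t < (f x).toReal} = 0 := by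
    rw [setLIntegral_congr_fun (g := fun _ => 0) measurableSet_Ici]
    · simp
    · intro t ht
      have : {x | t < (f x).toReal} = ∅ := by
        ext x
        simpa using (ENNReal.toReal_mono ENNReal.one_ne_top (hf1 x)).trans (by simpa using ht)
      simp [this]
  rw [h0, add_zero]
  refine setLIntegral_congr_fun measurableSet_Ioo fun t ht => ?_
  simp only [ENNReal.ofReal_lt_iff_lt_toReal ht.1.le (hfin _)]

theorem lintegral_add_lintegral_le_of_iSup_eq_one {f g h : ℝ → ℝ≥0∞} (hf : Measurable f)
    (hg : Measurable g) (hh : Measurable h) (hf1 : ⨆ x, f x = 1) (hg1 : ⨆ x, g x = 1)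
    (hfgh : ∀ x y, f x * g y ≤ h ((1 / 2 : ℝ) • (x + y)) ^ 2) :
    (∫⁻ x, f x) + ∫⁻ x, g x ≤ 2 * ∫⁻ x, h x := by
  have hle : ∫⁻ x, min (h x) 1 ≤ ∫⁻ x, h x := lintegral_mono fun x => min_le_left _ _
  refine le_trans ?_ (mul_le_mul_right hle 2)
  rw [lintegral_eq_lintegral_volume_lt hf fun x => hf1 ▸ le_iSup f x,
    lintegral_eq_lintegral_volume_lt hg fun x => hg1 ▸ le_iSup g x,
    lintegral_eq_lintegral_volume_lt (hh.min measurable_const) fun x => min_le_right _ _]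
  have hanti : ∀ k : ℝ → ℝ≥0∞, Measurable fun t : ℝ => volume {x | ENNReal.ofReal t < k x} :=
    fun k => Antitone.measurable fun s t hst => measure_mono fun x hx =>
      lt_of_le_of_lt (ENNReal.ofReal_le_ofReal hst) hx
  rw [← lintegral_add_left (hanti f), ← lintegral_const_mul _ (hanti _)]
  refine setLIntegral_mono' measurableSet_Ioo fun t ht => ?_
  have ht1 : ENNReal.ofReal t < 1 := by simpa using ht.2
  refine volume_add_volume_le_two_mul (measurableSet_lt measurable_const hf)
    (measurableSet_lt measurable_const hg) (lt_iSup_iff.1 (ht1.trans_eq hf1.symm) :)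
    (lt_iSup_iff.1 (ht1.trans_eq hg1.symm) :) fun x hx y hy => lt_min ?_ ht1
  by_contra hlt
  have h1 := (hfgh x y).trans (pow_le_pow_left' (not_lt.1 hlt) 2)
  exact absurd h1 (not_le.2 (by rw [sq]; exact ENNReal.mul_lt_mul hx hy))

theorem ENNReal.mul_le_sq_of_add_le_two_mul {a b c : ℝ≥0∞} (h : a + b ≤ 2 * c) :
    a * b ≤ c ^ 2 := by
  rcases eq_or_ne c ∞ with rfl | hc
  · simp
  have hab : a + b ≠ ∞ := ne_top_of_le_ne_top (ENNReal.mul_ne_top ENNReal.ofNat_ne_top hc) h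
  lift a to NNReal using (ENNReal.add_ne_top.1 hab).1
  lift b to NNReal using (ENNReal.add_ne_top.1 hab).2
  lift c to NNReal using hc
  norm_cast at h ⊢
  have h' : (a : ℝ) + b ≤ 2 * c := by exact_mod_cast h
  have : (a : ℝ) * b ≤ c ^ 2 := by
    nlinarith [sq_nonneg ((a : ℝ) - b), a.coe_nonneg, b.coe_nonneg]
  exact_mod_cast this

theorem lintegral_mul_lintegral_le_of_iSup_ne_top {f g h : ℝ → ℝ≥0∞} (hf : Measurable f)
    (hg : Measurable g) (hh : Measurable h) (hF : ⨆ x, f x ≠ ∞) (hG : ⨆ x, g x ≠ ∞)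
    (hfgh : ∀ x y, f x * g y ≤ h ((1 / 2 : ℝ) • (x + y)) ^ 2) :
    (∫⁻ x, f x) * ∫⁻ x, g x ≤ (∫⁻ x, h x) ^ 2 := by
  rcases eq_or_ne (⨆ x, f x) 0 with hF0 | hF0
  · simp [funext (ENNReal.iSup_eq_zero.1 hF0)]
  rcases eq_or_ne (⨆ x, g x) 0 with hG0 | hG0
  · simp [funext (ENNReal.iSup_eq_zero.1 hG0)]
  set F := ⨆ x, f x
  set G := ⨆ x, g x
  obtain ⟨c, hc⟩ : ∃ c : ℝ≥0∞, c ^ 2 = F * G :=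
    ⟨(F * G) ^ (1 / 2 : ℝ), by rw [← ENNReal.rpow_natCast, ← ENNReal.rpow_mul]; simp⟩
  have hFG : F * G ≠ 0 := mul_ne_zero hF0 hG0
  have hFG' : F * G ≠ ∞ := ENNReal.mul_ne_top hF hG
  have hinv : (F * G)⁻¹ = F⁻¹ * G⁻¹ := ENNReal.mul_inv (.inl hF0) (.inl hF)
  have hc2 : c⁻¹ ^ 2 = F⁻¹ * G⁻¹ := by rw [← ENNReal.inv_pow, hc, hinv]
  have key := ENNReal.mul_le_sq_of_add_le_two_mul <|
    lintegral_add_lintegral_le_of_iSup_eq_one (f := fun x => F⁻¹ * f x)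
    (g := fun x => G⁻¹ * g x) (h := fun x => c⁻¹ * h x) (hf.const_mul _) (hg.const_mul _)
    (hh.const_mul _) (by rw [← ENNReal.mul_iSup, ENNReal.inv_mul_cancel hF0 hF])
    (by rw [← ENNReal.mul_iSup, ENNReal.inv_mul_cancel hG0 hG]) fun x y => by
      rw [mul_pow, hc2, mul_mul_mul_comm]
      exact mul_le_mul_right (hfgh x y) _
  rw [lintegral_const_mul _ hf, lintegral_const_mul _ hg, lintegral_const_mul _ hh, mul_pow, hc2,
    mul_mul_mul_comm, ← hinv] at key
  exact (ENNReal.mul_le_mul_iff_right (ENNReal.inv_ne_zero.2 hFG') (ENNReal.inv_ne_top.2 hFG)).1 key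

/-- The measure `μ` satisfies the Prékopa–Leindler inequality for midpoints. -/
def PrekopaLeindler {E : Type*} [AddCommGroup E] [Module ℝ E] [MeasurableSpace E]
    (μ : Measure E) : Prop :=
  ∀ f g h : E → ℝ≥0∞, Measurable f → Measurable g → Measurable h →
    (∀ x y, f x * g y ≤ h ((1 / 2 : ℝ) • (x + y)) ^ 2) →
    (∫⁻ x, f x ∂μ) * ∫⁻ x, g x ∂μ ≤ (∫⁻ x, h x ∂μ) ^ 2

theorem prekopaLeindler_real : PrekopaLeindler (volume : Measure ℝ) := by
  intro f g h hf hg hh hfgh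
  have htrunc : ∀ k : ℝ → ℝ≥0∞, Measurable k →
      ∫⁻ x, k x = ⨆ n : ℕ, ∫⁻ x, min (k x) n := by
    intro k hk
    rw [← lintegral_iSup (fun n => hk.min measurable_const)
      fun m n hmn x => min_le_min_left _ (by exact_mod_cast hmn)]
    congr 1 with x
    rw [← inf_iSup_eq, ENNReal.iSup_natCast, inf_top_eq]
  rw [htrunc f hf, htrunc g hg, ENNReal.iSup_mul]
  refine iSup_le fun i => ?_
  rw [ENNReal.mul_iSup]
  refine iSup_le fun j => ?_
  refine lintegral_mul_lintegral_le_of_iSup_ne_top (hf.min measurable_const)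
    (hg.min measurable_const) hh ?_ ?_ fun x y =>
      (mul_le_mul' (min_le_left _ _) (min_le_left _ _)).trans (hfgh x y)
  · exact ne_top_of_le_ne_top (ENNReal.natCast_ne_top i) (iSup_le fun x => min_le_right _ _)
  · exact ne_top_of_le_ne_top (ENNReal.natCast_ne_top j) (iSup_le fun x => min_le_right _ _)

theorem PrekopaLeindler.prod {E F : Type*} [AddCommGroup E] [Module ℝ E] [MeasurableSpace E]
    [AddCommGroup F] [Module ℝ F] [MeasurableSpace F] {μ : Measure E} {ν : Measure F}
    [SFinite ν] (hμ : PrekopaLeindler μ) (hν : PrekopaLeindler ν) :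
    PrekopaLeindler (μ.prod ν) := by
  intro f g h hf hg hh hfgh
  rw [lintegral_prod _ hf.aemeasurable, lintegral_prod _ hg.aemeasurable,
    lintegral_prod _ hh.aemeasurable]
  exact hμ _ _ _ hf.lintegral_prod_right' hg.lintegral_prod_right' hh.lintegral_prod_right'
    fun x₁ x₂ => hν _ _ _ (hf.comp measurable_prodMk_left) (hg.comp measurable_prodMk_left)
      (hh.comp measurable_prodMk_left) fun y₁ y₂ => hfgh (x₁, y₁) (x₂, y₂)

theorem PrekopaLeindler.map {E F : Type*} [AddCommGroup E] [Module ℝ E] [MeasurableSpace E]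
    [AddCommGroup F] [Module ℝ F] [MeasurableSpace F] {μ : Measure E} {ν : Measure F}
    (hμ : PrekopaLeindler μ) (e : E →ₗ[ℝ] F) (he : MeasurePreserving e μ ν) :
    PrekopaLeindler ν := by
  intro f g h hf hg hh hfgh
  rw [← he.lintegral_comp hf, ← he.lintegral_comp hg, ← he.lintegral_comp hh]
  exact hμ _ _ _ (hf.comp he.measurable) (hg.comp he.measurable) (hh.comp he.measurable)
    fun x y => by simpa only [Function.comp, map_smul, map_add] using hfgh (e x) (e y)

theorem prekopaLeindler_pi (n : ℕ) : PrekopaLeindler (volume : Measure (Fin n → ℝ)) := by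
  induction n with
  | zero =>
    intro f g h _ _ _ hfgh
    simp only [lintegral_unique, volume_pi, Measure.pi_univ, Finset.univ_eq_empty,
      Finset.prod_empty, mul_one]
    convert hfgh default default
  | succ n ih =>
    exact (prekopaLeindler_real.prod ih).map
      { toFun := (MeasurableEquiv.piFinSuccAbove (fun _ => ℝ) 0).symm
        map_add' := fun x y => by
          ext i; refine Fin.cases ?_ (fun j => ?_) i <;> simp [MeasurableEquiv.piFinSuccAbove]
        map_smul' := fun c x => by
          ext i; refine Fin.cases ?_ (fun j => ?_) i <;> simp [MeasurableEquiv.piFinSuccAbove] }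
      (volume_preserving_piFinSuccAbove (fun _ : Fin (n + 1) => ℝ) 0).symm

theorem prekopaLeindler_volume (E : Type*) [NormedAddCommGroup E] [InnerProductSpace ℝ E]
    [FiniteDimensional ℝ E] [MeasurableSpace E] [BorelSpace E] :
    PrekopaLeindler (volume : Measure E) :=
  ((prekopaLeindler_pi _).map
    (WithLp.linearEquiv 2 ℝ (Fin (Module.finrank ℝ E) → ℝ)).symm.toLinearMap
    (PiLp.volume_preserving_toLp _)).map
    (stdOrthonormalBasis ℝ E).repr.symm.toLinearEquiv.toLinearMap
    (stdOrthonormalBasis ℝ E).measurePreserving_repr_symm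

/-- A Gaussian form of the Prékopa–Leindler inequality, applied to a function and its reflection. -/
theorem lintegral_exp_gaussOf_le_of_midpoint {E : Type*} [NormedAddCommGroup E]
    [InnerProductSpace ℝ E] [FiniteDimensional ℝ E] [MeasurableSpace E] [BorelSpace E]
    {φ ψ : E → ℝ} (hφ : Measurable φ) (hψ : Measurable ψ)
    (hφψ : ∀ a b, (φ a - ‖a‖ ^ 2 / 2) + (φ (-b) - ‖b‖ ^ 2 / 2) ≤
      2 * (ψ ((1 / 2 : ℝ) • (a + b)) - ‖(1 / 2 : ℝ) • (a + b)‖ ^ 2 / 2)) :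
    ∫⁻ x, ENNReal.ofReal (Real.exp (φ x)) ∂gaussOf E ≤
      ∫⁻ x, ENNReal.ofReal (Real.exp (ψ x)) ∂gaussOf E := by
  unfold gaussOf
  have hc : 0 ≤ (2 * π) ^ (-(Module.finrank ℝ E : ℝ) / 2) := by positivity
  generalize (2 * π) ^ (-(Module.finrank ℝ E : ℝ) / 2) = c at hc ⊢
  have hdens : Measurable fun x : E => ENNReal.ofReal (c * Real.exp (-‖x‖ ^ 2 / 2)) := by
    fun_prop
  have hdensity : ∀ {χ : E → ℝ}, Measurable χ →
      ∫⁻ x, ENNReal.ofReal (Real.exp (χ x))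
          ∂volume.withDensity (fun x : E => ENNReal.ofReal (c * Real.exp (-‖x‖ ^ 2 / 2))) =
        ∫⁻ x, ENNReal.ofReal (c * Real.exp (χ x - ‖x‖ ^ 2 / 2)) := by
    intro χ hχ
    rw [lintegral_withDensity_eq_lintegral_mul _ hdens hχ.exp.ennreal_ofReal]
    refine lintegral_congr fun x => ?_
    rw [Pi.mul_apply, ← ENNReal.ofReal_mul (by positivity), mul_assoc, ← Real.exp_add]
    ring_nf
  rw [hdensity hφ, hdensity hψ]
  set f : E → ℝ≥0∞ := fun x => ENNReal.ofReal (c * Real.exp (φ x - ‖x‖ ^ 2 / 2)) with hf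
  have hf_meas : Measurable f := by fun_prop
  have key := prekopaLeindler_volume E f (fun x => f (-x))
    (fun x => ENNReal.ofReal (c * Real.exp (ψ x - ‖x‖ ^ 2 / 2))) hf_meas
    (hf_meas.comp measurable_neg) (by fun_prop) fun a b => by
      simp only [hf, norm_neg]
      rw [← ENNReal.ofReal_mul (by positivity), ← ENNReal.ofReal_pow (by positivity),
        mul_mul_mul_comm, ← Real.exp_add, mul_pow, ← Real.exp_nat_mul, ← sq]
      gcongr
      exact hφψ a b
  rw [lintegral_neg_eq_self f, ← sq] at key
  exact (ENNReal.pow_le_pow_left_iff two_ne_zero).1 key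

theorem S2_bddBelow {E₁ E₂ : Type*} [NormedAddCommGroup E₂] {g : E₁ → E₂ → ℝ} {m : ℝ}
    (hm : ∀ x y, m ≤ g x y) (x : E₁) (y : E₂) :
    BddBelow (Set.range fun v : E₂ => (g x (v + y) + g x (v - y)) / 2 + ‖v‖ ^ 2 / 2) := by
  refine ⟨m, ?_⟩
  rintro _ ⟨v, rfl⟩
  have := hm x (v + y)
  have := hm x (v - y)
  dsimp only
  nlinarith [sq_nonneg ‖v‖]

theorem le_S2 {E₁ E₂ : Type*} [NormedAddCommGroup E₂] {g : E₁ → E₂ → ℝ} {m : ℝ}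
    (hm : ∀ x y, m ≤ g x y) (x : E₁) (y : E₂) :
    m ≤ S2 g x y := by
  refine le_ciInf fun v => ?_
  have := hm x (v + y)
  have := hm x (v - y)
  nlinarith [sq_nonneg ‖v‖]

section Symmetrisation

variable {E₁ E₂ : Type*} [NormedAddCommGroup E₁] [NormedAddCommGroup E₂]

theorem H2_bddBelow {g : E₁ → E₂ → ℝ} {m : ℝ} (hm : ∀ x y, m ≤ g x y) (x : E₁) (y : E₂) :
    BddBelow (Set.range fun p : E₁ × E₂ =>
      g (x + p.1) (y + p.2) + ‖p.1‖ ^ 2 / 2 + ‖p.2‖ ^ 2 / 2) := by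
  refine ⟨m, ?_⟩
  rintro _ ⟨p, rfl⟩
  have := hm (x + p.1) (y + p.2)
  dsimp only
  nlinarith [sq_nonneg ‖p.1‖, sq_nonneg ‖p.2‖]

theorem upperSemicontinuous_H2 {g : E₁ → E₂ → ℝ} {m : ℝ} (hm : ∀ x y, m ≤ g x y)
    (hg : UpperSemicontinuous fun q : E₁ × E₂ => g q.1 q.2) :
    UpperSemicontinuous fun q : E₁ × E₂ => H2 g q.1 q.2 := by
  refine upperSemicontinuous_ciInf (fun q => H2_bddBelow hm q.1 q.2) fun p => ?_
  have hshift : UpperSemicontinuous fun q : E₁ × E₂ => g (q.1 + p.1) (q.2 + p.2) :=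
    hg.comp (g := fun q : E₁ × E₂ => (q.1 + p.1, q.2 + p.2)) (by fun_prop)
  exact (hshift.add continuous_const.upperSemicontinuous).add
    continuous_const.upperSemicontinuous

theorem upperSemicontinuous_S2 {g : E₁ → E₂ → ℝ} {m : ℝ} (hm : ∀ x y, m ≤ g x y)
    (hg : Continuous (Function.uncurry g)) :
    UpperSemicontinuous fun q : E₁ × E₂ => S2 g q.1 q.2 := by
  refine upperSemicontinuous_ciInf (fun q => S2_bddBelow hm q.1 q.2) fun v => ?_
  have hadd : Continuous fun q : E₁ × E₂ => g q.1 (v + q.2) :=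
    hg.comp (g := Function.uncurry g) (f := fun q : E₁ × E₂ => (q.1, v + q.2)) (by fun_prop)
  have hsub : Continuous fun q : E₁ × E₂ => g q.1 (v - q.2) :=
    hg.comp (g := Function.uncurry g) (f := fun q : E₁ × E₂ => (q.1, v - q.2)) (by fun_prop)
  exact Continuous.upperSemicontinuous (by fun_prop)

theorem H2_add_H2_neg_le [InnerProductSpace ℝ E₁] [InnerProductSpace ℝ E₂]
    {g : E₁ → E₂ → ℝ} {m : ℝ} (hm : ∀ x y, m ≤ g x y)
    (hg_even : ∀ x y, g (-x) (-y) = g x y) (a b : E₁) (y : E₂) :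
    (H2 g a y - ‖a‖ ^ 2 / 2) + (H2 g (-b) y - ‖b‖ ^ 2 / 2) ≤
      2 * (H2 (S2 g) ((1 / 2 : ℝ) • (a + b)) y - ‖(1 / 2 : ℝ) • (a + b)‖ ^ 2 / 2) := by
  set x := (1 / 2 : ℝ) • (a + b) with hx
  suffices h : (H2 g a y - ‖a‖ ^ 2 / 2 + (H2 g (-b) y - ‖b‖ ^ 2 / 2)) / 2 + ‖x‖ ^ 2 / 2 ≤
      H2 (S2 g) x y by linarith
  refine le_ciInf fun ⟨u, w⟩ => ?_
  suffices h : (H2 g a y - ‖a‖ ^ 2 / 2 + (H2 g (-b) y - ‖b‖ ^ 2 / 2)) / 2 + ‖x‖ ^ 2 / 2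
      - ‖u‖ ^ 2 / 2 - ‖w‖ ^ 2 / 2 ≤ S2 g (x + u) (y + w) by
    dsimp only
    linarith
  refine le_ciInf fun v => ?_
  have h₁ : H2 g a y ≤ _ := ciInf_le (H2_bddBelow hm a y) (x + u - a, w + v)
  have h₂ : H2 g (-b) y ≤ _ := ciInf_le (H2_bddBelow hm (-b) y) (b - (x + u), w - v)
  have e₁ : a + (x + u - a) = x + u := by abel
  have e₂ : y + (w + v) = v + (y + w) := by abel
  have e₃ : g (-b + (b - (x + u))) (y + (w - v)) = g (x + u) (v - (y + w)) := by
    rw [← hg_even (x + u)]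
    congr 1 <;> abel
  dsimp only at h₁ h₂
  rw [e₁, e₂] at h₁
  rw [e₃] at h₂
  have hpar := parallelogram_law_with_norm ℝ w v
  have hquad : ‖x + u - a‖ ^ 2 + ‖b - (x + u)‖ ^ 2 - ‖a‖ ^ 2 - ‖b‖ ^ 2 =
      2 * ‖u‖ ^ 2 - 2 * ‖x‖ ^ 2 := by
    have hb : b = (2 : ℝ) • x - a := by rw [hx]; module
    rw [hb]
    simp only [← real_inner_self_eq_norm_sq, inner_add_left, inner_add_right, inner_sub_left,
      inner_sub_right, real_inner_smul_left, real_inner_smul_right]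
    rw [real_inner_comm x u, real_inner_comm x a, real_inner_comm a u]
    ring
  linarith

end Symmetrisation

/-- Partial symmetrisation increases `∫ e^{Hg}`: for a continuous, even, bounded
from below `g` on `E₁ × E₂`, `∫ e^{Hg} dγ₁⊗γ₂ ≤ ∫ e^{H S₂ g} dγ₁⊗γ₂`. -/
theorem lintegral_exp_H_le_symmetrisation
    {E₁ E₂ : Type*}
    [NormedAddCommGroup E₁] [InnerProductSpace ℝ E₁] [FiniteDimensional ℝ E₁]
    [MeasurableSpace E₁] [BorelSpace E₁]
    [NormedAddCommGroup E₂] [InnerProductSpace ℝ E₂] [FiniteDimensional ℝ E₂]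
    [MeasurableSpace E₂] [BorelSpace E₂]
    (g : E₁ → E₂ → ℝ) (hg_cont : Continuous (Function.uncurry g))
    (hg_even : ∀ x y, g (-x) (-y) = g x y)
    (hg_bdd : BddBelow (Set.range (Function.uncurry g))) :
    (∫⁻ p : E₁ × E₂, ENNReal.ofReal (Real.exp (H2 g p.1 p.2))
        ∂(gaussOf E₁).prod (gaussOf E₂)) ≤
      ∫⁻ p : E₁ × E₂, ENNReal.ofReal (Real.exp (H2 (S2 g) p.1 p.2))
        ∂(gaussOf E₁).prod (gaussOf E₂) := by
  obtain ⟨m, hm'⟩ := hg_bdd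
  have hm : ∀ x y, m ≤ g x y := fun x y => hm' ⟨(x, y), rfl⟩
  have hmeas : Measurable fun p : E₁ × E₂ => H2 g p.1 p.2 :=
    (upperSemicontinuous_H2 hm hg_cont.upperSemicontinuous).measurable
  have hmeasS : Measurable fun p : E₁ × E₂ => H2 (S2 g) p.1 p.2 :=
    (upperSemicontinuous_H2 (le_S2 hm) (upperSemicontinuous_S2 hm hg_cont)).measurable
  have : SFinite (gaussOf E₁) := by unfold gaussOf; infer_instance
  have : SFinite (gaussOf E₂) := by unfold gaussOf; infer_instance
  rw [lintegral_prod_symm' _ hmeas.exp.ennreal_ofReal,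
    lintegral_prod_symm' _ hmeasS.exp.ennreal_ofReal]
  refine lintegral_mono fun y => ?_
  have hy : Measurable fun x => H2 g x y := by fun_prop
  have hyS : Measurable fun x => H2 (S2 g) x y := by fun_prop
  exact lintegral_exp_gaussOf_le_of_midpoint hy hyS (H2_add_H2_neg_le hm hg_even · · y)
end
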